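/- arXiv:2502.06013 — 4 statements merged into one kernel-verified Lean document; each statement's English description precedes it below -/
import Mathlib

section
/- Suppose a simple graph G (on n ≥ 3 vertices) has vertices a, b, c, d such that: (1) the neighborhood of a is exactly {b, c, d}; (2) the neighborhood of b is exactly {a, c, d}; (3) there exists a path in G from c to d with at least two edges that avoids a and b. Then G is not ensnaring. -/
open scoped Classical

/-- The state space `Ξₙ` for a graph on vertex set `V` with `n = |V|`: a state `(v, i, ε)`
consists of a bijection `v` from the vertices to the positions `ℤ/n` (the replica of vertex
`a` sits at position `v a`; positions increase clockwise), the index `i : ℤ/n`, and the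
orientation `ε ∈ {±1}` encoded as a `Bool` (`true` = `+1`, `false` = `-1`). -/
abbrev Xi (V : Type*) [Fintype V] : Type _ :=
  (V ≃ ZMod (Fintype.card V)) × ZMod (Fintype.card V) × Bool

/-- The orientation `ε` as an element of `ℤ/n`. -/
def epsZ (n : ℕ) (e : Bool) : ZMod n := if e then 1 else -1

/-- Refractive toric promotion `Θ_G`:
`Θ_G (v,i,ε) = (s̄ᵢ v, i+ε, ε)` if `{v⁻¹(i), v⁻¹(i+1)}` is not an edge of `G`, and
`Θ_G (v,i,ε) = (s̄ᵢ v, i−ε, −ε)` if it is an edge of `G`.  Here `s̄ᵢ v` swaps the replicas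
sitting at positions `i` and `i+1`. -/
noncomputable def theta {V : Type*} [Fintype V] (G : SimpleGraph V) (D : Xi V) : Xi V :=
  if G.Adj (D.1.symm D.2.1) (D.1.symm (D.2.1 + 1)) then
    (D.1.trans (Equiv.swap D.2.1 (D.2.1 + 1)), D.2.1 - epsZ _ D.2.2, !D.2.2)
  else
    (D.1.trans (Equiv.swap D.2.1 (D.2.1 + 1)), D.2.1 + epsZ _ D.2.2, D.2.2)

/-- The net number of clockwise steps that the replica of vertex `a` makes during one
application of `Θ_G` to the state `D`: each application swaps the replicas at positions
`i` and `i+1`, moving the former one step clockwise and the latter one step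
counterclockwise. -/
def disp {V : Type*} [Fintype V] (D : Xi V) (a : V) : ℤ :=
  if D.1 a = D.2.1 then 1 else if D.1 a = D.2.1 + 1 then -1 else 0

/-- `n` times the winding number `w_O(a)` of vertex `a` with respect to the orbit `O` of the
state `D` under `Θ_G`: the net number of clockwise steps made by the replica of `a` during
`P` consecutive applications of `Θ_G` starting from `D`, where `P` is the size of the orbit
(i.e. the minimal period of `D`).  The winding number itself is `windSum G D a / n`; in
particular `w_O(a) = 0` iff `windSum G D a = 0`, and `w_O(a) = w_O(b)` iff
`windSum G D a = windSum G D b`. -/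
noncomputable def windSum {V : Type*} [Fintype V] (G : SimpleGraph V) (D : Xi V) (a : V) : ℤ :=
  ∑ k ∈ Finset.range (Function.minimalPeriod (theta G) D), disp ((theta G)^[k] D) a

/-- The winding vector of the orbit of `D` under `Θ_G` is zero. -/
def WindingVectorZero {V : Type*} [Fintype V] (G : SimpleGraph V) (D : Xi V) : Prop :=
  ∀ a : V, windSum G D a = 0

/-- `G` is ensnaring if every orbit of `Θ_G` has winding vector `0`. -/
def Ensnaring {V : Type*} [Fintype V] (G : SimpleGraph V) : Prop :=
  ∀ D : Xi V, WindingVectorZero G D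

/-- `G` is expelling if no orbit of `Θ_G` has winding vector `0`. -/
def Expelling {V : Type*} [Fintype V] (G : SimpleGraph V) : Prop :=
  ∀ D : Xi V, ¬ WindingVectorZero G D

section Aux

set_option linter.unusedSectionVars false

variable {V : Type*} [Fintype V]

/-- `a` sits at `i` and `b` at `i+1`. -/
def PSt (a b : V) (S : Xi V) : Prop := S.1 a = S.2.1 ∧ S.1 b = S.2.1 + 1

/-- Reversal combined with swapping the labels `a`, `b`. -/
noncomputable def sig (a b : V) (S : Xi V) : Xi V :=
  ((Equiv.swap a b).trans S.1, S.2.1 - epsZ _ S.2.2, !S.2.2)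

lemma epsZ_not (n : ℕ) (e : Bool) : epsZ n (!e) = - epsZ n e := by
  cases e <;> simp [epsZ]

lemma sig_sig (a b : V) (S : Xi V) : sig a b (sig a b S) = S := by
  obtain ⟨v, i, e⟩ := S
  simp only [sig, epsZ_not, Bool.not_not]
  refine Prod.ext ?_ (Prod.ext ?_ rfl)
  · ext x; simp
  · simp

lemma theta_fst (G : SimpleGraph V) (S : Xi V) :
    (theta G S).1 = S.1.trans (Equiv.swap S.2.1 (S.2.1 + 1)) := by
  unfold theta; split_ifs <;> rfl

lemma sig_theta_fst (G : SimpleGraph V) (a b : V) (S : Xi V) :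
    (sig a b (theta G S)).1
      = (Equiv.swap a b).trans (S.1.trans (Equiv.swap S.2.1 (S.2.1 + 1))) := by
  simp [sig, theta_fst]

lemma sig_theta_snd (G : SimpleGraph V) (a b : V) (S : Xi V) :
    (sig a b (theta G S)).2.1 = S.2.1 := by
  unfold sig theta; split_ifs <;> simp [epsZ_not]

lemma swap_adj (G : SimpleGraph V) (a b : V)
    (htw : ∀ x, x ≠ a → x ≠ b → (G.Adj a x ↔ G.Adj b x)) (x y : V) :
    G.Adj (Equiv.swap a b x) (Equiv.swap a b y) ↔ G.Adj x y := by
  have := htw x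
  have := htw y
  simp only [Equiv.swap_apply_def]
  split_ifs <;> grind [SimpleGraph.Adj.symm, SimpleGraph.irrefl]

lemma theta_sig_theta (G : SimpleGraph V) (a b : V)
    (htw : ∀ x, x ≠ a → x ≠ b → (G.Adj a x ↔ G.Adj b x)) (S : Xi V) :
    theta G (sig a b (theta G S)) = sig a b S := by
  have h1 := sig_theta_fst G a b S
  have h2 := sig_theta_snd G a b S
  have h3 : (sig a b (theta G S)).2.2
      = if G.Adj (S.1.symm S.2.1) (S.1.symm (S.2.1 + 1)) then S.2.2 else !S.2.2 := by
    unfold sig theta; split_ifs <;> simp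
  have hadj : G.Adj ((sig a b (theta G S)).1.symm (sig a b (theta G S)).2.1)
      ((sig a b (theta G S)).1.symm ((sig a b (theta G S)).2.1 + 1)) ↔
      G.Adj (S.1.symm S.2.1) (S.1.symm (S.2.1 + 1)) := by
    rw [h1, h2]
    simp only [Equiv.symm_trans_apply, Equiv.symm_swap, Equiv.swap_apply_left,
      Equiv.swap_apply_right]
    rw [swap_adj G a b htw, G.adj_comm]
  have h4 : (sig a b (theta G S)).1.trans (Equiv.swap S.2.1 (S.2.1 + 1))
      = (Equiv.swap a b).trans S.1 := by
    rw [h1]; ext x; simp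
  generalize sig a b (theta G S) = T at *
  unfold theta
  simp only [hadj]
  rw [h2, h3, h4]
  split_ifs
  · rfl
  · simp [sig, epsZ_not, sub_eq_add_neg]

lemma sig_theta_of_P (G : SimpleGraph V) (a b : V) (hab : G.Adj a b) (S : Xi V)
    (h : PSt a b S) : sig a b (theta G S) = S := by
  have h1 := sig_theta_fst G a b S
  have h2 := sig_theta_snd G a b S
  have h3 : (sig a b (theta G S)).2.2
      = if G.Adj (S.1.symm S.2.1) (S.1.symm (S.2.1 + 1)) then S.2.2 else !S.2.2 := by
    unfold sig theta; split_ifs <;> simp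
  obtain ⟨ha, hb⟩ := h
  have hA : S.1.symm S.2.1 = a := by rw [← ha]; simp
  have hB : S.1.symm (S.2.1 + 1) = b := by rw [← hb]; simp
  rw [hA, hB, if_pos hab] at h3
  refine Prod.ext ?_ (Prod.ext h2 h3)
  rw [h1]
  ext x
  rw [Equiv.trans_apply, Equiv.trans_apply]
  by_cases hxa : x = a
  · subst hxa; rw [Equiv.swap_apply_left, hb, ha, Equiv.swap_apply_right]
  · by_cases hxb : x = b
    · subst hxb; rw [Equiv.swap_apply_right, hb, ha, Equiv.swap_apply_left]
    · rw [Equiv.swap_apply_of_ne_of_ne hxa hxb, Equiv.swap_apply_of_ne_of_ne]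
      · rw [← ha]; simpa using hxa
      · rw [← hb]; simpa using hxb

lemma M_of_sig_theta (G : SimpleGraph V) (a b : V) (S : Xi V)
    (h : PSt b a (sig a b (theta G S))) : PSt b a S := by
  obtain ⟨h1, h2⟩ := h
  rw [sig_theta_fst, sig_theta_snd] at h1 h2
  simp only [Equiv.trans_apply, Equiv.swap_apply_left, Equiv.swap_apply_right] at h1 h2
  rw [Equiv.swap_apply_eq_iff] at h1 h2
  simp only [Equiv.swap_apply_left, Equiv.swap_apply_right] at h1 h2
  exact ⟨h2, h1⟩

lemma iter_sig (G : SimpleGraph V) (a b : V)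
    (htw : ∀ x, x ≠ a → x ≠ b → (G.Adj a x ↔ G.Adj b x)) (j : ℕ) (S : Xi V) :
    (theta G)^[j] (sig a b ((theta G)^[j] S)) = sig a b S := by
  induction j generalizing S with
  | zero => rfl
  | succ j ih =>
    rw [Function.iterate_succ_apply' (theta G) j S, Function.iterate_succ_apply,
      theta_sig_theta G a b htw, ih]

/-- Gap from `b` to `a`. -/
def gap (a b : V) (S : Xi V) : ℤ := ((S.1 a - S.1 b).val : ℤ)

lemma val_aux (n : ℕ) (hn : 3 ≤ n) (x : ZMod n) (m : ℤ) (h : (m : ZMod n) = x)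
    (h0 : 0 ≤ m) (h1 : m < n) : (x.val : ℤ) = m := by
  subst h
  have : NeZero n := ⟨by omega⟩
  rw [ZMod.val_intCast, Int.emod_eq_of_lt h0 h1]

lemma num_gap (n : ℕ) (hn : 3 ≤ n) (i p q : ZMod n) (hne : p ≠ q) :
    ((if p = i then 1 else if p = i + 1 then -1 else 0)
      - (if q = i then 1 else if q = i + 1 then -1 else 0) : ℤ) =
    ((Equiv.swap i (i + 1) p - Equiv.swap i (i + 1) q).val : ℤ) - ((p - q).val : ℤ)
      + n * ((if p = i ∧ q = i + 1 then 1 else 0) - (if q = i ∧ p = i + 1 then 1 else 0)) := by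
  have : NeZero n := ⟨by omega⟩
  have : Fact (1 < n) := ⟨by omega⟩
  have h10 : (1 : ZMod n) ≠ 0 := one_ne_zero
  have hi : i + 1 ≠ i := by simp
  have hlt : ((p - q).val : ℤ) < n := by exact_mod_cast ZMod.val_lt _
  have hpos : 0 < ((p - q).val : ℤ) := by
    have : (p - q).val ≠ 0 := by rw [Ne, ZMod.val_eq_zero, sub_eq_zero]; exact hne
    omega
  have hcast : ((((p - q).val : ℤ)) : ZMod n) = p - q := by
    simp
  have key : ∀ (x : ZMod n) (δ : ℤ), x = p - q + (δ : ZMod n) → x ≠ 0 → (δ = 1 ∨ δ = -1) →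
      (x.val : ℤ) = ((p - q).val : ℤ) + δ := by
    intro x δ hx hx0 hδ
    have e1 : ((((p - q).val : ℤ) + δ : ℤ) : ZMod n) = x := by
      rw [Int.cast_add, hcast, hx]
    apply val_aux n hn x _ e1
    · omega
    · rcases lt_or_eq_of_le (show ((p - q).val : ℤ) + δ ≤ n by omega) with h | h
      · exact h
      · rw [h] at e1; simp at e1; exact absurd e1.symm hx0
  have hone : ∀ x : ZMod n, x = 1 → (x.val : ℤ) = 1 := fun x hx =>
    val_aux n hn x 1 (by simp [hx]) (by omega) (by omega)
  have hmone : ∀ x : ZMod n, x = -1 → (x.val : ℤ) = n - 1 := fun x hx =>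
    val_aux n hn x (n - 1) (by simp [hx]) (by omega) (by omega)
  by_cases hp1 : p = i
  · by_cases hq1 : q = i + 1
    · subst hp1 hq1
      rw [Equiv.swap_apply_left, Equiv.swap_apply_right]
      rw [hone (p + 1 - p) (by ring), hmone (p - (p + 1)) (by ring)]
      simp
      ring
    · have hq2 : q ≠ i := fun h => hne (hp1.trans h.symm)
      subst hp1
      rw [Equiv.swap_apply_left, Equiv.swap_apply_of_ne_of_ne hq2 hq1,
        key (p + 1 - q) 1 (by push_cast; ring) (sub_ne_zero.2 (Ne.symm hq1)) (by simp)]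
      simp [hq1, hq2]
  · by_cases hp2 : p = i + 1
    · by_cases hq1 : q = i
      · subst hq1 hp2
        rw [Equiv.swap_apply_left, Equiv.swap_apply_right]
        rw [hone (q + 1 - q) (by ring), hmone (q - (q + 1)) (by ring)]
        simp
        ring
      · have hq2 : q ≠ i + 1 := fun h => hne (hp2.trans h.symm)
        subst hp2
        rw [Equiv.swap_apply_right, Equiv.swap_apply_of_ne_of_ne hq1 hq2,
          key (i - q) (-1) (by push_cast; ring) (sub_ne_zero.2 (Ne.symm hq1)) (by simp)]
        simp [hq1, hq2]
    · rw [Equiv.swap_apply_of_ne_of_ne hp1 hp2]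
      by_cases hq1 : q = i
      · subst hq1
        rw [Equiv.swap_apply_left,
          key (p - (q + 1)) (-1) (by push_cast; ring) (sub_ne_zero.2 hp2) (by simp)]
        simp [hp1, hp2]
      · by_cases hq2 : q = i + 1
        · subst hq2
          rw [Equiv.swap_apply_right,
            key (p - i) 1 (by push_cast; ring) (sub_ne_zero.2 hp1) (by simp)]
          simp [hp1, hp2]
        · rw [Equiv.swap_apply_of_ne_of_ne hq1 hq2]
          simp [hp1, hp2, hq1, hq2]

lemma disp_gap (G : SimpleGraph V) (hn : 3 ≤ Fintype.card V) (a b : V) (hab : a ≠ b)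
    (S : Xi V) :
    disp S a - disp S b = gap a b (theta G S) - gap a b S
      + Fintype.card V * ((if PSt a b S then 1 else 0) - (if PSt b a S then 1 else 0)) := by
  have hg : gap a b (theta G S) = ((Equiv.swap S.2.1 (S.2.1 + 1) (S.1 a)
      - Equiv.swap S.2.1 (S.2.1 + 1) (S.1 b)).val : ℤ) := by
    simp [gap, theta_fst]
  rw [hg]
  have h := num_gap (Fintype.card V) hn S.2.1 (S.1 a) (S.1 b)
    (fun h => hab (S.1.injective h))
  unfold gap disp PSt
  convert h using 6

lemma not_M_of_P (hn : 3 ≤ Fintype.card V) (a b : V) (S : Xi V) (h : PSt a b S) :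
    ¬ PSt b a S := by
  intro h'
  have : Fact (1 < Fintype.card V) := ⟨by omega⟩
  have := h.1.symm.trans h'.2
  simp at this

/-- Reaching without an `a`-`b` swap. -/
def Run (G : SimpleGraph V) (a b : V) (S T : Xi V) : Prop :=
  ∃ N, (theta G)^[N] S = T ∧
    ∀ j < N, ¬ PSt a b ((theta G)^[j] S) ∧ ¬ PSt b a ((theta G)^[j] S)

lemma dyn_main (G : SimpleGraph V) (hn : 3 ≤ Fintype.card V) (a b : V) (hab : G.Adj a b)
    (htw : ∀ x, x ≠ a → x ≠ b → (G.Adj a x ↔ G.Adj b x)) (D S1 : Xi V)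
    (hD : PSt a b D) (hS : PSt a b S1) (hrun : Run G a b (theta G D) S1) :
    ¬ Ensnaring G := by
  intro hE
  obtain ⟨N, hN, hav⟩ := hrun
  have hne : a ≠ b := hab.ne
  have hfS : theta G S1 = sig a b S1 := by
    conv_rhs => rw [← sig_theta_of_P G a b hab S1 hS]
    rw [sig_sig]
  have hback : ∀ j ≤ N, (theta G)^[j] (theta G S1)
      = sig a b ((theta G)^[N - j] (theta G D)) := by
    intro j hj
    rw [hfS, ← hN]
    have : (theta G)^[N] (theta G D) = (theta G)^[j] ((theta G)^[N - j] (theta G D)) := by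
      rw [← Function.iterate_add_apply]; congr 2; omega
    rw [this, iter_sig G a b htw]
  have hS1 : S1 = (theta G)^[N + 1] D := by rw [Function.iterate_succ_apply, hN]
  have hper : (theta G)^[2 * N + 2] D = D := by
    have h1 := hback N le_rfl
    simp only [Nat.sub_self, Function.iterate_zero, id] at h1
    rw [sig_theta_of_P G a b hab D hD, hS1, ← Function.iterate_succ_apply' (theta G),
      ← Function.iterate_add_apply] at h1
    convert h1 using 2
    omega
  have hM : ∀ k < 2 * N + 2, ¬ PSt b a ((theta G)^[k] D) := by
    intro k hk
    rcases Nat.eq_zero_or_pos k with rfl | hk0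
    · exact not_M_of_P hn a b _ hD
    · obtain ⟨k, rfl⟩ : ∃ m, k = m + 1 := ⟨k - 1, by omega⟩
      rw [Function.iterate_succ_apply]
      rcases lt_trichotomy k N with h | h | h
      · exact (hav k h).2
      · rw [h, hN]; exact not_M_of_P hn a b _ hS
      · obtain ⟨j, rfl⟩ : ∃ j, k = j + (N + 1) := ⟨k - (N + 1), by omega⟩
        rw [Function.iterate_add_apply, Function.iterate_succ_apply' (theta G) N, hN,
          hback j (by omega)]
        obtain ⟨m, hm⟩ : ∃ m, N - j = m + 1 := ⟨N - j - 1, by omega⟩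
        rw [hm, Function.iterate_succ_apply']
        intro hc
        exact (hav m (by omega)).2 (M_of_sig_theta G a b _ hc)
  have hpp : Function.IsPeriodicPt (theta G) (2 * N + 2) D := hper
  set p := Function.minimalPeriod (theta G) D with hp
  have hple : p ≤ 2 * N + 2 := hpp.minimalPeriod_le (by omega)
  have hp0 : 0 < p := hpp.minimalPeriod_pos (by omega)
  have hsum : windSum G D a - windSum G D b
      = Fintype.card V * ∑ k ∈ Finset.range p,
        ((if PSt a b ((theta G)^[k] D) then (1 : ℤ) else 0)
          - (if PSt b a ((theta G)^[k] D) then 1 else 0)) := by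
    unfold windSum
    rw [← hp, ← Finset.sum_sub_distrib, Finset.mul_sum]
    have : ∀ k, disp ((theta G)^[k] D) a - disp ((theta G)^[k] D) b
        = (gap a b ((theta G)^[k + 1] D) - gap a b ((theta G)^[k] D))
          + Fintype.card V * ((if PSt a b ((theta G)^[k] D) then (1 : ℤ) else 0)
          - (if PSt b a ((theta G)^[k] D) then 1 else 0)) := by
      intro k
      rw [disp_gap G hn a b hne, Function.iterate_succ_apply']
    simp_rw [this]
    rw [Finset.sum_add_distrib, Finset.sum_range_sub (fun k => gap a b ((theta G)^[k] D))]
    simp only [Function.iterate_zero, id, hp, Function.iterate_minimalPeriod]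
    simp
  rw [hE D a, hE D b] at hsum
  have hpos : 0 < ∑ k ∈ Finset.range p,
        ((if PSt a b ((theta G)^[k] D) then (1 : ℤ) else 0)
          - (if PSt b a ((theta G)^[k] D) then 1 else 0)) := by
    apply Finset.sum_pos'
    · intro k hk
      rw [if_neg (hM k (by have := Finset.mem_range.1 hk; omega))]
      split_ifs <;> simp
    · refine ⟨0, Finset.mem_range.2 hp0, ?_⟩
      rw [if_neg (hM 0 (by omega))]
      simp [hD]
  have hc : (0 : ℤ) < Fintype.card V := by exact_mod_cast (by omega : 0 < Fintype.card V)
  have := mul_pos hc hpos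
  omega

/-- positions of a list in arithmetic progression -/
def pc {n : ℕ} (v : V → ZMod n) (s : ZMod n) : ZMod n → List V → Prop
  | _, [] => True
  | r, x :: l => v x = r ∧ pc v s (r + s) l

lemma pc_append {n : ℕ} (v : V → ZMod n) (s r : ZMod n) (l m : List V) :
    pc v s r (l ++ m) ↔ pc v s r l ∧ pc v s (r + l.length * s) m := by
  induction l generalizing r with
  | nil => simp [pc]
  | cons x l ih =>
    simp only [List.cons_append, pc, ih, List.length_cons, and_assoc]
    have : r + s + l.length * s = r + ((l.length + 1 : ℕ) : ZMod n) * s := by push_cast; ring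
    rw [this]

lemma pc_reverse {n : ℕ} (v : V → ZMod n) (s r : ZMod n) (l : List V)
    (h : pc v s r l) : pc v (-s) (r + l.length * s - s) l.reverse := by
  induction l generalizing r with
  | nil => simp [pc]
  | cons x l ih =>
    obtain ⟨h1, h2⟩ := h
    rw [List.reverse_cons, pc_append]
    have := ih _ h2
    refine ⟨?_, ?_, trivial⟩
    · convert this using 1
      simp only [List.length_cons]; push_cast; ring
    · simp only [List.length_reverse, List.length_cons, h1]; push_cast; ring

lemma pc_congr {n : ℕ} (v w : V → ZMod n) (s r : ZMod n) (l : List V)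
    (h : pc v s r l) (hv : ∀ x ∈ l, w x = v x) : pc w s r l := by
  induction l generalizing r with
  | nil => trivial
  | cons x l ih =>
    exact ⟨(hv x (by simp)).trans h.1, ih _ h.2 (fun y hy => hv y (by simp [hy]))⟩

def LRep (S : Xi V) (e : Bool) (l : List V) : Prop :=
  S.2.2 = e ∧ l.Nodup ∧ l.length = Fintype.card V ∧
    pc S.1 (epsZ _ e) (S.2.1 + if e then 0 else 1) l

inductive LStep (G : SimpleGraph V) (a b : V) : Bool × List V → Bool × List V → Prop
  | pass (e x z t) (h : ¬ G.Adj x z) : LStep G a b (e, x :: z :: t) (e, x :: (t ++ [z]))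
  | hit (e x y t) (h : G.Adj x y) (h1 : ¬ (x = a ∧ y = b)) (h2 : ¬ (x = b ∧ y = a)) :
      LStep G a b (e, x :: y :: t) (!e, y :: (t.reverse ++ [x]))

/-- Facts about the first two elements. -/
lemma LRep.swap_eq {S : Xi V} {e : Bool} {x z : V} {t : List V} (h : LRep S e (x :: z :: t)) :
    (e = true ∧ S.1 x = S.2.1 ∧ S.1 z = S.2.1 + 1) ∨
    (e = false ∧ S.1 x = S.2.1 + 1 ∧ S.1 z = S.2.1) := by
  obtain ⟨h1, h2, h3, h4, h5, h6⟩ := h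
  cases e <;> simp [epsZ] at h4 h5 <;> simp [h4, h5]

lemma LRep.adj_iff {S : Xi V} {e : Bool} {x z : V} {t : List V} (G : SimpleGraph V)
    (h : LRep S e (x :: z :: t)) :
    G.Adj (S.1.symm S.2.1) (S.1.symm (S.2.1 + 1)) ↔ G.Adj x z := by
  rcases h.swap_eq with ⟨_, h1, h2⟩ | ⟨_, h1, h2⟩
  · rw [← h2, ← h1]; simp
  · rw [← h1, ← h2]; simp [G.adj_comm]

lemma LRep.fst {S : Xi V} {e : Bool} {x z : V} {t : List V} (G : SimpleGraph V)
    (h : LRep S e (x :: z :: t)) :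
    (theta G S).1 x = S.1 z ∧ (theta G S).1 z = S.1 x ∧ ∀ w ∈ t, (theta G S).1 w = S.1 w := by
  have hnd := h.2.1
  have hw : ∀ w ∈ t, w ≠ x ∧ w ≠ z := by
    intro w hw; constructor <;> rintro rfl <;> simp [hw] at hnd
  rw [theta_fst]
  rcases h.swap_eq with ⟨_, h1, h2⟩ | ⟨_, h1, h2⟩
  · rw [← h2, ← h1]
    refine ⟨by simp, by simp, fun w hh => ?_⟩
    rw [Equiv.trans_apply, Equiv.swap_apply_of_ne_of_ne] <;>
      simp [hw w hh]
  · rw [← h1, ← h2]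
    refine ⟨by simp, by simp, fun w hh => ?_⟩
    rw [Equiv.trans_apply, Equiv.swap_apply_of_ne_of_ne] <;>
      simp [hw w hh]

lemma LStep.rep {G : SimpleGraph V} {a b : V} (hab : G.Adj a b) {p q : Bool × List V}
    (h : LStep G a b p q) {S : Xi V} (hS : LRep S p.1 p.2) :
    LRep (theta G S) q.1 q.2 ∧ ¬ PSt a b S ∧ ¬ PSt b a S := by
  cases h with
  | pass e x z t h =>
    have hadj := hS.adj_iff G
    obtain ⟨f1, f2, f3⟩ := hS.fst G
    obtain ⟨g1, g2, g3, g4, g5, g6⟩ := hS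
    have hcard : (t.length : ZMod (Fintype.card V)) = -2 := by
      have : ((t.length + 2 : ℕ) : ZMod (Fintype.card V)) = 0 := by
        rw [← ZMod.natCast_self (Fintype.card V), ← g3]; rfl
      push_cast at this
      linear_combination this
    refine ⟨⟨?_, ?_, ?_, ?_⟩, ?_, ?_⟩
    · simp [theta, hadj, h, g1]
    · simp at g2 ⊢; grind
    · simpa using g3
    · have hi : (theta G S).2.1 = S.2.1 + epsZ _ e := by
        simp [theta, hadj, h]; rw [g1]
      rw [hi]
      refine ⟨?_, ?_⟩
      · rw [f1, g5]; ring
      · rw [pc_append]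
        refine ⟨pc_congr _ _ _ _ _ ?_ f3, ?_, trivial⟩
        · convert g6 using 1; ring
        · rw [f2, g4, hcard]; ring
    · rintro ⟨h1, h2⟩
      rw [← h2, ← h1] at hadj; simp [hab, h] at hadj
    · rintro ⟨h1, h2⟩
      rw [← h2, ← h1] at hadj; simp [hab.symm, h] at hadj
  | hit e x y t h hh1 hh2 =>
    have hadj := hS.adj_iff G
    have hsw := hS.swap_eq
    obtain ⟨f1, f2, f3⟩ := hS.fst G
    obtain ⟨g1, g2, g3, g4, g5, g6⟩ := hS
    have hcard : (t.length : ZMod (Fintype.card V)) = -2 := by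
      have : ((t.length + 2 : ℕ) : ZMod (Fintype.card V)) = 0 := by
        rw [← ZMod.natCast_self (Fintype.card V), ← g3]; rfl
      push_cast at this
      linear_combination this
    refine ⟨⟨?_, ?_, ?_, ?_⟩, ?_, ?_⟩
    · simp [theta, hadj, h, g1]
    · simp at g2 ⊢; grind
    · simpa using g3
    · have hi : (theta G S).2.1 + (if (!e) = true then 0 else 1)
          = S.2.1 + if e then 0 else 1 := by
        simp [theta, hadj, h]; rw [g1]; cases e <;> simp [epsZ]
      dsimp only
      rw [hi, epsZ_not]
      refine ⟨?_, ?_⟩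
      · rw [f2, g4]
      · rw [pc_append]
        refine ⟨pc_congr _ _ _ _ _ ?_ (fun w hw => f3 w (by simpa using hw)), ?_, trivial⟩
        · convert pc_reverse _ _ _ _ g6 using 1; rw [hcard]; ring
        · rw [f1, g5, List.length_reverse, hcard]; ring
    · rintro ⟨h1, h2⟩
      rcases hsw with ⟨_, k1, k2⟩ | ⟨_, k1, k2⟩
      · exact hh1 ⟨S.1.injective (k1.trans h1.symm), S.1.injective (k2.trans h2.symm)⟩
      · exact hh2 ⟨S.1.injective (k1.trans h2.symm), S.1.injective (k2.trans h1.symm)⟩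
    · rintro ⟨h1, h2⟩
      rcases hsw with ⟨_, k1, k2⟩ | ⟨_, k1, k2⟩
      · exact hh2 ⟨S.1.injective (k1.trans h1.symm), S.1.injective (k2.trans h2.symm)⟩
      · exact hh1 ⟨S.1.injective (k1.trans h2.symm), S.1.injective (k2.trans h1.symm)⟩

abbrev LRun (G : SimpleGraph V) (a b : V) := Relation.ReflTransGen (LStep G a b)

lemma LRun.run {G : SimpleGraph V} {a b : V} (hab : G.Adj a b) {p q : Bool × List V}
    (h : LRun G a b p q) {S : Xi V} (hS : LRep S p.1 p.2) :
    ∃ T, Run G a b S T ∧ LRep T q.1 q.2 := by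
  induction h with
  | refl => exact ⟨S, ⟨0, rfl, by simp⟩, hS⟩
  | tail _ hs ih =>
    obtain ⟨T, ⟨N, hN, hav⟩, hT⟩ := ih
    obtain ⟨k1, k2⟩ := hs.rep hab hT
    refine ⟨theta G T, ⟨N + 1, by rw [Function.iterate_succ_apply', hN], fun j hj => ?_⟩, k1⟩
    rcases Nat.lt_succ_iff_lt_or_eq.1 hj with h | rfl
    · exact hav j h
    · rw [hN]; exact k2

lemma lrun_pass (G : SimpleGraph V) (a b : V) (e : Bool) (x : V) (u t : List V)
    (hu : ∀ z ∈ u, ¬ G.Adj x z) : LRun G a b (e, x :: (u ++ t)) (e, x :: (t ++ u)) := by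
  induction u generalizing t with
  | nil => simpa using Relation.ReflTransGen.refl
  | cons z u ih =>
    refine Relation.ReflTransGen.head (LStep.pass e x z (u ++ t) (hu z (by simp))) ?_
    have := ih (t ++ [z]) (fun w hw => hu w (by simp [hw]))
    simpa using this

lemma lrun_hit (G : SimpleGraph V) (a b : V) (e : Bool) (x y : V) (u t : List V)
    (hu : ∀ z ∈ u, ¬ G.Adj x z) (h : G.Adj x y) (h1 : ¬ (x = a ∧ y = b))
    (h2 : ¬ (x = b ∧ y = a)) :
    LRun G a b (e, x :: (u ++ y :: t)) (!e, y :: (u.reverse ++ t.reverse ++ [x])) := by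
  refine (lrun_pass G a b e x u (y :: t) hu).tail ?_
  have := LStep.hit (a := a) (b := b) e x y (t ++ u) h h1 h2
  simpa using this

/-- Induced interior list from `y` to `c`. -/
def Gd (G : SimpleGraph V) (c : V) : V → List V → Prop
  | y, [] => G.Adj y c
  | y, z :: p => G.Adj y z ∧ ¬ G.Adj y c ∧ (∀ w ∈ p, ¬ G.Adj y w) ∧ Gd G c z p

def arr (W : List V) : List V → List V
  | [] => W
  | z :: p => z :: (arr W p).reverse

lemma arr_perm (W p : List V) : (arr W p).Perm (p ++ W) := by
  induction p with
  | nil => simp [arr]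
  | cons z p ih => exact List.Perm.cons _ ((List.reverse_perm _).trans ih)

lemma chain_run (G : SimpleGraph V) (a b c : V) (W : List V)
    (hac : G.Adj a c) (hbc : G.Adj b c) (p : List V) :
    ∀ (e : Bool) (α β y prev : V) (A B : List V),
      ((e = true ∧ α = a ∧ β = b) ∨ (e = false ∧ α = b ∧ β = a)) →
      Gd G c y p →
      (∀ w ∈ y :: p, ¬ G.Adj w a ∧ ¬ G.Adj w b ∧ w ≠ a ∧ w ≠ b) →
      (∀ z ∈ A, ∀ w ∈ y :: p, ¬ G.Adj w z) →
      (∀ z ∈ B, ∀ w ∈ y :: p, ¬ G.Adj w z) →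
      (∀ w ∈ p, ¬ G.Adj w prev) →
      ∃ e' α' β' t, ((e' = true ∧ α' = a ∧ β' = b) ∨ (e' = false ∧ α' = b ∧ β' = a)) ∧
        LRun G a b (e, y :: ((A ++ α :: c :: β :: B) ++ (arr W p ++ [prev])))
          (e', α' :: β' :: t) := by
  have hca : c ≠ a := hac.ne'
  have hcb : c ≠ b := hbc.ne'
  induction p with
  | nil =>
    intro e α β y prev A B hK hg hw hA hB hp
    have hy := hw y (by simp)
    have hyα : ¬ G.Adj y α := by rcases hK with ⟨_, rfl, rfl⟩ | ⟨_, rfl, rfl⟩ <;> tauto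
    have hcα : G.Adj c α := by
      rcases hK with ⟨_, rfl, rfl⟩ | ⟨_, rfl, rfl⟩
      · exact hac.symm
      · exact hbc.symm
    refine ⟨e, α, β, B ++ W ++ [prev] ++ A ++ [c] ++ [y], hK, ?_⟩
    have s1 := lrun_hit G a b e y c (A ++ [α]) (β :: B ++ (W ++ [prev]))
      (by intro z hz
          rcases List.mem_append.1 hz with hz | hz
          · exact hA z hz y (by simp)
          · rw [List.mem_singleton.1 hz]; exact hyα) hg (by tauto) (by tauto)
    have s2 := lrun_hit G a b (!e) c α []
      (A.reverse ++ (β :: B ++ (W ++ [prev])).reverse ++ [y]) (by simp) hcα (by tauto) (by tauto)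
    have s3 := lrun_pass G a b e α [y] (β :: B ++ W ++ [prev] ++ A ++ [c])
      (by simpa [G.adj_comm] using hyα)
    refine Relation.ReflTransGen.trans (b := (!e, c :: ([] ++ α ::
      (A.reverse ++ (β :: B ++ (W ++ [prev])).reverse ++ [y])))) ?_
      (Relation.ReflTransGen.trans
        (b := (e, α :: ([y] ++ (β :: B ++ W ++ [prev] ++ A ++ [c])))) ?_ ?_)
    · simpa [arr] using s1
    · simpa using s2
    · simpa using s3
  | cons z p ih =>
    intro e α β y prev A B hK hg hw hA hB hp
    obtain ⟨g1, g2, g3, g4⟩ := hg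
    have hy := hw y (by simp)
    have hyα : ¬ G.Adj y α := by rcases hK with ⟨_, rfl, rfl⟩ | ⟨_, rfl, rfl⟩ <;> tauto
    have hyβ : ¬ G.Adj y β := by rcases hK with ⟨_, rfl, rfl⟩ | ⟨_, rfl, rfl⟩ <;> tauto
    have s1 := lrun_hit G a b e y z (A ++ α :: c :: β :: B) ((arr W p).reverse ++ [prev])
      (by intro x hx
          simp only [List.mem_append, List.mem_cons] at hx
          rcases hx with hx | rfl | rfl | rfl | hx
          · exact hA x hx y (by simp)
          · exact hyα
          · exact g2
          · exact hyβ
          · exact hB x hx y (by simp)) g1 (by tauto) (by tauto)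
    obtain ⟨e', α', β', t, hK', hr⟩ := ih (!e) β α z y B.reverse (A.reverse ++ [prev])
      (by cases e <;> simp at hK ⊢ <;> tauto) g4
      (fun w h => hw w (by simp at h ⊢; tauto))
      (fun x hx w h => hB x (by simpa using hx) w (by simp at h ⊢; tauto))
      (by intro x hx w h
          simp only [List.mem_append, List.mem_reverse, List.mem_singleton] at hx
          rcases hx with hx | rfl
          · exact hA x hx w (by simp at h ⊢; tauto)
          · exact hp w h)
      (fun w h => by rw [G.adj_comm]; exact g3 w h)
    refine ⟨e', α', β', t, hK', Relation.ReflTransGen.trans ?_ hr⟩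
    simpa [arr] using s1

lemma last_adj (G : SimpleGraph V) (y : V) (q : List V) (h : ∃ w ∈ q, G.Adj y w) :
    ∃ l w m, q = l ++ w :: m ∧ G.Adj y w ∧ ∀ x ∈ m, ¬ G.Adj y x := by
  induction q with
  | nil => simp at h
  | cons z q ih =>
    by_cases hq : ∃ w ∈ q, G.Adj y w
    · obtain ⟨l, w, m, rfl, h1, h2⟩ := ih hq
      exact ⟨z :: l, w, m, rfl, h1, h2⟩
    · refine ⟨[], z, q, rfl, ?_, by simpa using hq⟩
      obtain ⟨w, hw, h1⟩ := h
      rcases List.mem_cons.1 hw with rfl | hw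
      · exact h1
      · exact absurd ⟨w, hw, h1⟩ hq

lemma exists_gd (G : SimpleGraph V) (c : V) (k : ℕ) : ∀ (y : V) (q : List V), q.length ≤ k →
    List.IsChain G.Adj (y :: (q ++ [c])) → ∃ q', q'.Sublist q ∧ Gd G c y q' := by
  induction k with
  | zero =>
    intro y q hq hc
    obtain rfl : q = [] := List.length_eq_zero_iff.1 (by omega)
    exact ⟨[], by simp, by simpa [Gd] using hc⟩
  | succ k ih =>
    intro y q hq hc
    by_cases hyc : G.Adj y c
    · exact ⟨[], by simp, hyc⟩
    · have hex : ∃ w ∈ q, G.Adj y w := by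
        cases q with
        | nil => simp at hc; exact absurd hc hyc
        | cons z q => simp at hc; exact ⟨z, by simp, hc.1⟩
      obtain ⟨l, w, m, rfl, h1, h2⟩ := last_adj G y q hex
      have hc' : List.IsChain G.Adj (w :: (m ++ [c])) := by
        refine hc.suffix ⟨y :: l, by simp⟩
      obtain ⟨q', hs, hg⟩ := ih w m (by simp at hq; omega) hc'
      refine ⟨w :: q', (hs.cons_cons w).trans (List.sublist_append_right _ _),
        h1, hyc, fun x hx => h2 x (hs.subset hx), hg⟩

lemma exists_rep (hn : 3 ≤ Fintype.card V) (l : List V) (hl : l.Nodup) (hmem : ∀ x, x ∈ l) :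
    ∃ S : Xi V, LRep S true l := by
  have hlen : l.length = Fintype.card V := by
    rw [← List.toFinset_card_of_nodup hl, ← Finset.card_univ]
    congr 1; ext x; simp [hmem]
  have : NeZero (Fintype.card V) := ⟨by omega⟩
  let f : V → ZMod (Fintype.card V) := fun x => (l.idxOf x : ZMod (Fintype.card V))
  have hinj : Function.Injective f := by
    intro x y hxy
    have h1 : l.idxOf x < Fintype.card V := hlen ▸ List.idxOf_lt_length_of_mem (hmem x)
    have h2 : l.idxOf y < Fintype.card V := hlen ▸ List.idxOf_lt_length_of_mem (hmem y)
    have h3 : l.idxOf x = l.idxOf y := by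
      have := congrArg ZMod.val hxy
      rwa [ZMod.val_natCast_of_lt h1, ZMod.val_natCast_of_lt h2] at this
    exact (List.idxOf_inj (hmem x)).1 h3
  have hbij : Function.Bijective f :=
    (Fintype.bijective_iff_injective_and_card f).2 ⟨hinj, by rw [ZMod.card]⟩
  refine ⟨(Equiv.ofBijective f hbij, 0, true), rfl, hl, hlen, ?_⟩
  have key : ∀ l2 l1 : List V, l = l1 ++ l2 → pc f 1 (l1.length : ZMod (Fintype.card V)) l2 := by
    intro l2
    induction l2 with
    | nil => intros; trivial
    | cons x l2 ih =>
      intro l1 h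
      refine ⟨?_, ?_⟩
      · have hx : x ∉ l1 := by
          rw [h] at hl; intro hx
          exact (List.nodup_append.1 hl).2.2 x hx x (by simp) rfl
        simp only [f]
        rw [h, List.idxOf_append_of_notMem hx]; simp
      · have := ih (l1 ++ [x]) (by simp [h])
        simpa using this
  have := key l [] rfl
  simpa [epsZ] using this

lemma LRep.P {S : Xi V} {e : Bool} {a b α β : V} {t : List V} (h : LRep S e (α :: β :: t))
    (hK : (e = true ∧ α = a ∧ β = b) ∨ (e = false ∧ α = b ∧ β = a)) : PSt a b S := by
  rcases hK with ⟨rfl, rfl, rfl⟩ | ⟨rfl, rfl, rfl⟩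
  · rcases h.swap_eq with ⟨_, h1, h2⟩ | ⟨h0, _⟩
    · exact ⟨h1, h2⟩
    · simp at h0
  · rcases h.swap_eq with ⟨h0, _⟩ | ⟨_, h1, h2⟩
    · simp at h0
    · exact ⟨h2, h1⟩

lemma rep_theta_hit {G : SimpleGraph V} {a b : V} {S : Xi V} {t : List V} (hab : G.Adj a b)
    {c : V} (hac : G.Adj a c) (hcb : c ≠ b)
    (h : LRep S true (a :: b :: t)) : LRep (theta G S) false (b :: (t.reverse ++ [a])) :=
  -- use the list step with a different pair of labels
  have hca := hac.ne
  ((LStep.hit (a := a) (b := c) true a b t hab (by tauto) (by tauto)).rep hac h).1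

lemma main_aux (G : SimpleGraph V) (hn : 3 ≤ Fintype.card V) (a b c d : V)
    (ha : G.neighborSet a = {b, c, d}) (hb : G.neighborSet b = {a, c, d}) (hcd : c ≠ d)
    (q : List V) (hq0 : q ≠ []) (hqn : q.Nodup)
    (hqm : ∀ w ∈ q, w ≠ a ∧ w ≠ b ∧ w ≠ c ∧ w ≠ d)
    (hc : List.IsChain G.Adj (d :: (q ++ [c]))) : ¬ Ensnaring G := by
  have hA : ∀ x, G.Adj a x ↔ x = b ∨ x = c ∨ x = d := by
    intro x; rw [← SimpleGraph.mem_neighborSet, ha]; simp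
  have hB : ∀ x, G.Adj b x ↔ x = a ∨ x = c ∨ x = d := by
    intro x; rw [← SimpleGraph.mem_neighborSet, hb]; simp
  have hab : G.Adj a b := (hA b).2 (by simp)
  have hac : G.Adj a c := (hA c).2 (by simp)
  have had : G.Adj a d := (hA d).2 (by simp)
  have hbc : G.Adj b c := (hB c).2 (by simp)
  have hbd : G.Adj b d := (hB d).2 (by simp)
  have htw : ∀ x, x ≠ a → x ≠ b → (G.Adj a x ↔ G.Adj b x) := by
    intro x h1 h2; rw [hA, hB]; tauto
  obtain ⟨y, p, hyp, hnd, hdy, hdp, hg⟩ : ∃ y p, (∀ w ∈ y :: p, w ∈ q) ∧ (y :: p).Nodup ∧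
      G.Adj d y ∧ (∀ w ∈ p, ¬ G.Adj d w) ∧ Gd G c y p := by
    have hex : ∃ w ∈ q, G.Adj d w := by
      cases q with
      | nil => simp at hq0
      | cons z q => simp at hc; exact ⟨z, by simp, hc.1⟩
    obtain ⟨l, w, m, rfl, h1, h2⟩ := last_adj G d q hex
    have hc' : List.IsChain G.Adj (w :: (m ++ [c])) := hc.suffix ⟨d :: l, by simp⟩
    obtain ⟨q', hs, hg⟩ := exists_gd G c _ w m le_rfl hc'
    have hsub : (w :: q').Sublist (l ++ w :: m) :=
      (hs.cons_cons w).trans (List.sublist_append_right _ _)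
    exact ⟨w, q', fun x hx => hsub.subset hx, hqn.sublist hsub, h1,
      fun x hx => h2 x (hs.subset hx), hg⟩
  have hyp' : ∀ w ∈ y :: p, w ≠ a ∧ w ≠ b ∧ w ≠ c ∧ w ≠ d := fun w hw => hqm w (hyp w hw)
  set W : List V := Finset.univ.toList.filter
    (fun x => x ∉ a :: b :: c :: d :: y :: p) with hW
  have hWm : ∀ x, x ∈ W ↔ x ∉ a :: b :: c :: d :: y :: p := by
    intro x; rw [hW, List.mem_filter]; simp
  have hWn : W.Nodup := (Finset.nodup_toList _).filter _
  have hperm : (a :: b :: c :: d :: arr W (y :: p)).Perm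
      ((a :: b :: c :: d :: y :: p) ++ W) :=
    ((((arr_perm W (y :: p)).cons d).cons c).cons b).cons a
  have hnd1 : (a :: b :: c :: d :: y :: p).Nodup := by
    have h1 := hab.ne
    have h2 := hac.ne
    have h3 := had.ne
    have h4 := hbc.ne
    have h5 := hbd.ne
    have f1 : a ∉ y :: p := fun h => (hyp' a h).1 rfl
    have f2 : b ∉ y :: p := fun h => (hyp' b h).2.1 rfl
    have f3 : c ∉ y :: p := fun h => (hyp' c h).2.2.1 rfl
    have f4 : d ∉ y :: p := fun h => (hyp' d h).2.2.2 rfl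
    rw [List.nodup_cons, List.nodup_cons, List.nodup_cons, List.nodup_cons]
    simp only [List.mem_cons] at *
    tauto
  have hndall : (a :: b :: c :: d :: arr W (y :: p)).Nodup := by
    rw [hperm.nodup_iff, List.nodup_append]
    refine ⟨hnd1, hWn, ?_⟩
    rintro x hx z hz rfl
    exact (hWm x).1 hz hx
  obtain ⟨D, hD⟩ := exists_rep hn _ hndall (by
    intro x; rw [hperm.mem_iff, List.mem_append, hWm]; tauto)
  have hDP : PSt a b D := hD.P (by simp)
  have hD1 := rep_theta_hit hab hac hbc.ne' hD
  have hnab : ∀ w ∈ y :: p, ¬ G.Adj w a ∧ ¬ G.Adj w b ∧ w ≠ a ∧ w ≠ b := by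
    intro w hw
    obtain ⟨h1, h2, h3, h4⟩ := hyp' w hw
    refine ⟨?_, ?_, h1, h2⟩
    · rw [G.adj_comm, hA]; tauto
    · rw [G.adj_comm, hB]; tauto
  have hnb : ∀ z ∈ arr W (y :: p), ¬ G.Adj b z := by
    intro z hz
    rw [(arr_perm W (y :: p)).mem_iff, List.mem_append, hWm] at hz
    rw [hB]
    rcases hz with hz | hz
    · have := hyp' z hz; tauto
    · simp only [List.mem_cons] at hz; tauto
  have s1 := lrun_hit G a b false b d (arr W (y :: p)).reverse [c, a]
    (by intro z hz; exact hnb z (by simpa using hz)) hbd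
    (by have := hab.ne; tauto) (by have := had.ne'; tauto)
  have s2 := lrun_hit G a b true d y [] ((arr W p).reverse ++ [a, c, b]) (by simp) hdy
    (by have := had.ne'; tauto) (by have := hbd.ne'; tauto)
  obtain ⟨e', α', β', t, hK, hr⟩ := chain_run G a b c W hac hbc p false b a y d [] []
    (by simp) hg hnab (by simp) (by simp) (fun w hw => by rw [G.adj_comm]; exact hdp w hw)
  have hrun : LRun G a b (false, b :: ((c :: d :: arr W (y :: p)).reverse ++ [a]))
      (e', α' :: β' :: t) := by
    refine Relation.ReflTransGen.trans
      (b := (true, d :: ([] ++ y :: ((arr W p).reverse ++ [a, c, b])))) ?_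
      (Relation.ReflTransGen.trans ?_ hr)
    · simpa [arr] using s1
    · simpa using s2
  obtain ⟨S1, hr1, hr2⟩ := hrun.run hab hD1
  exact dyn_main G hn a b hab htw D S1 hDP (hr2.P hK) hr1

end Aux

/-- Suppose a graph `G` on `n ≥ 3` vertices has vertices `a, b, c, d`
such that the neighborhood of `a` is exactly `{b, c, d}`, the neighborhood of `b` is
exactly `{a, c, d}`, and there is a path in `G` from `c` to `d` with at least two edges
avoiding `a` and `b`.  Then `G` is not ensnaring. -/
theorem stmt_12 (n : ℕ) (hn : 3 ≤ n) (G : SimpleGraph (Fin n)) (a b c d : Fin n)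
    (ha : G.neighborSet a = {b, c, d})
    (hb : G.neighborSet b = {a, c, d})
    (hpath : ∃ p : G.Walk c d, p.IsPath ∧ 2 ≤ p.length ∧ a ∉ p.support ∧ b ∉ p.support) :
    ¬ Ensnaring G := by
  obtain ⟨p, hp, hlen, hpa, hpb⟩ := hpath
  have hnd : p.reverse.support.Nodup := hp.reverse.support_nodup
  have hch := p.reverse.isChain_adj_support
  have hl : p.reverse.support.length = p.length + 1 := by simp
  have hma : a ∉ p.reverse.support := by simpa using hpa
  have hmb : b ∉ p.reverse.support := by simpa using hpb
  obtain ⟨q, hq⟩ : ∃ q, p.reverse.support = d :: (q ++ [c]) := by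
    have hne : p.reverse.support.tail ≠ [] := by
      intro h
      have := congrArg List.length h
      rw [List.length_tail, hl, List.length_nil] at this
      omega
    refine ⟨p.reverse.support.tail.dropLast, ?_⟩
    have h1 : p.reverse.support.tail.getLast hne = c := by
      rw [List.getLast_tail]; exact p.reverse.getLast_support
    have h2 := List.dropLast_append_getLast hne
    rw [h1] at h2
    rw [h2]
    exact p.reverse.cons_tail_support.symm
  rw [hq] at hnd hch hl hma hmb
  have hcd : c ≠ d := by rintro rfl; simp at hnd
  refine main_aux G (by simpa using hn) a b c d ha hb hcd q ?_ ?_ ?_ hch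
  · rintro rfl; simp at hl; omega
  · simp only [List.nodup_cons, List.nodup_append] at hnd; exact hnd.2.1
  · intro w hw
    refine ⟨?_, ?_, ?_, ?_⟩
    · rintro rfl; simp [hw] at hma
    · rintro rfl; simp [hw] at hmb
    · rintro rfl
      simp only [List.nodup_cons, List.nodup_append] at hnd
      exact hnd.2.2.2 w hw w (by simp) rfl
    · rintro rfl; simp [hw] at hnd
end

section
/- For all integers n ≥ m ≥ 2 with n ≥ 3, the graph compl_n(K_m) (the n-vertex complement of the complete graph K_m) is not ensnaring. -/
open scoped Classical

/-- The graph `H` (on `Fin m`) viewed as a graph on `Fin n` (for `m ≤ n`) by adding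
isolated vertices. -/
def spread (m n : ℕ) (H : SimpleGraph (Fin m)) : SimpleGraph (Fin n) :=
  SimpleGraph.fromRel (fun a b =>
    ∃ (ha : (a : ℕ) < m) (hb : (b : ℕ) < m), H.Adj ⟨(a : ℕ), ha⟩ ⟨(b : ℕ), hb⟩)

/-- The `n`-vertex complement `compl_n(H)` of an `m`-vertex graph `H`: the `n`-vertex graph
whose complement is the disjoint union of `H` with `n - m` isolated vertices. -/
def compln (m n : ℕ) (H : SimpleGraph (Fin m)) : SimpleGraph (Fin n) :=
  (spread m n H)ᶜ


section Aux

variable {V : Type*} [Fintype V]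

theorem aux_theta_inj (G : SimpleGraph V) : Function.Injective (theta G) := by
  rintro ⟨v, i, e⟩ ⟨v', i', e'⟩ h
  have key : ∀ (D : Xi V), (theta G D).2.1 - epsZ _ (theta G D).2.2 = D.2.1 := by
    rintro ⟨v, i, e⟩
    unfold theta
    split_ifs <;> cases e <;> simp [epsZ]
  have h1 : ∀ (D : Xi V), (theta G D).1 = D.1.trans (Equiv.swap D.2.1 (D.2.1 + 1)) := by
    intro D
    unfold theta
    split_ifs <;> rfl
  have hi : i = i' := by
    have a := key ⟨v, i, e⟩
    have b := key ⟨v', i', e'⟩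
    rw [h] at a
    exact a.symm.trans b
  subst hi
  have hv : v = v' := by
    have a := h1 ⟨v, i, e⟩
    have b := h1 ⟨v', i, e'⟩
    rw [h] at a
    have c := a.symm.trans b
    ext x
    have d := congrArg (fun f => f x) c
    simpa using d
  subst hv
  have he : e = e' := by
    have c := congrArg (fun D => D.2.2) h
    unfold theta at c
    dsimp only at c
    split_ifs at c <;> simpa using c
  subst he
  rfl

/-- invariant -/
def AuxInv (B : V → Prop) (D : Xi V) : Prop :=
  (D.2.2 = true ∧ B (D.1.symm D.2.1) ∧ B (D.1.symm (D.2.1 - 1))) ∨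
  (D.2.2 = false ∧ B (D.1.symm D.2.1) ∧ ¬ B (D.1.symm (D.2.1 + 1)) ∧ B (D.1.symm (D.2.1 + 1 + 1))) ∨
  (D.2.2 = true ∧ B (D.1.symm D.2.1) ∧ B (D.1.symm (D.2.1 + 1)))

theorem aux_one (h3 : 3 ≤ Fintype.card V) : (1 : ZMod (Fintype.card V)) ≠ 0 := by
  have : Fact (1 < Fintype.card V) := ⟨by omega⟩
  exact one_ne_zero

theorem aux_two (h3 : 3 ≤ Fintype.card V) : (1 + 1 : ZMod (Fintype.card V)) ≠ 0 := by
  intro h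
  have h' : ((2 : ℕ) : ZMod (Fintype.card V)) = 0 := by
    push_cast
    rw [← h]; norm_num
  rw [ZMod.natCast_eq_zero_iff] at h'
  have := Nat.le_of_dvd (by norm_num) h'
  omega

theorem aux_inv_step (G : SimpleGraph V) (B : V → Prop)
    (hG : ∀ a b, G.Adj a b ↔ a ≠ b ∧ ¬ (B a ∧ B b)) (h3 : 3 ≤ Fintype.card V)
    (D : Xi V) (h : AuxInv B D) : AuxInv B (theta G D) := by
  obtain ⟨v, i, e⟩ := D
  have o := aux_one h3
  have t := aux_two h3
  have n1 : i ≠ i + 1 := by simpa using o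
  have n2 : i - 1 ≠ i := by simpa using o
  have n3 : i - 1 ≠ i + 1 := by
    intro hh; apply t; linear_combination -hh
  have n4 : i + 1 + 1 ≠ i := by
    intro hh; apply t; linear_combination hh
  have n5 : i + 1 + 1 ≠ i + 1 := by simpa using o
  have ne : v.symm i ≠ v.symm (i + 1) := fun hh => n1 (v.symm.injective hh)
  have s2 := Equiv.swap_apply_of_ne_of_ne n2 n3
  have s4 := Equiv.swap_apply_of_ne_of_ne n4 n5
  unfold AuxInv at h
  rcases h with ⟨he, h1, h2⟩ | ⟨he, h1, h2, h4⟩ | ⟨he, h1, h2⟩ <;> dsimp only at he h1 h2 <;> subst he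
  · by_cases hb : B (v.symm (i + 1))
    · left
      simp [theta, hG, h1, hb, epsZ]
    · right; left
      simp [theta, hG, h1, hb, epsZ, ne, h2, s2]
  · right; right
    dsimp only at h4
    simp [theta, hG, h1, h2, epsZ, ne, h4, s4]
  · left
    simp [theta, hG, h1, h2, epsZ]

theorem aux_main (G : SimpleGraph V) (B : V → Prop)
    (hG : ∀ a b, G.Adj a b ↔ a ≠ b ∧ ¬ (B a ∧ B b)) (h3 : 3 ≤ Fintype.card V)
    (a b : V) (hab : a ≠ b) (ha : B a) (hb : B b) : ¬ Ensnaring G := by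
  intro hE
  have : NeZero (Fintype.card V) := ⟨by omega⟩
  have o := aux_one h3
  obtain ⟨f⟩ : Nonempty (V ≃ ZMod (Fintype.card V)) :=
    ⟨Fintype.equivOfCardEq (ZMod.card _).symm⟩
  obtain ⟨g, hg⟩ : ∃ g : V ≃ ZMod (Fintype.card V), g b = g a - 1 := by
    refine ⟨f.trans (Equiv.swap (f b) (f a - 1)), ?_⟩
    have q : Equiv.swap (f b) (f a - 1) (f a) = f a :=
      Equiv.swap_apply_of_ne_of_ne (fun h => hab (f.injective h)) (by
        intro hh; apply o; linear_combination hh)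
    simp [q]
  let D : Xi V := (g, g a, true)
  have hD : AuxInv B D := by
    left
    simp [D, ← hg, ha, hb]
  have hinv : ∀ k, AuxInv B ((theta G)^[k] D) := by
    intro k
    induction k with
    | zero => exact hD
    | succ k ih =>
      rw [Function.iterate_succ_apply']
      exact aux_inv_step G B hG h3 _ ih
  have hB : ∀ k, B (((theta G)^[k] D).1.symm ((theta G)^[k] D).2.1) := by
    intro k
    rcases hinv k with h | h | h
    · exact h.2.1
    · exact h.2.1
    · exact h.2.1
  set P := Function.minimalPeriod (theta G) D with hP
  have hPpos : 0 < P := by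
    apply Function.minimalPeriod_pos_of_mem_periodicPts
    exact (aux_theta_inj G).mem_periodicPts D
  have hred : ∀ r, ¬ B r → ∀ k < P, ((theta G)^[k] D).1 r ≠ ((theta G)^[k] D).2.1 + 1 := by
    intro r hr k hk heq
    have hne : ∀ k, ((theta G)^[k] D).1 r ≠ ((theta G)^[k] D).2.1 := by
      intro k hh
      apply hr
      have := hB k
      rw [← hh] at this
      simpa using this
    have hle : ∀ k ∈ Finset.range P, disp ((theta G)^[k] D) r ≤ 0 := by
      intro k _
      unfold disp
      rw [if_neg (hne k)]
      split_ifs <;> simp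
    have hz : ∑ k ∈ Finset.range P, disp ((theta G)^[k] D) r = 0 := hE D r
    have := (Finset.sum_eq_zero_iff_of_nonpos hle).1 hz k (Finset.mem_range.2 hk)
    unfold disp at this
    rw [if_neg (hne k), if_pos heq] at this
    simp at this
  have hcarry : ∀ k ≤ P, ((theta G)^[k] D).1 a = ((theta G)^[k] D).2.1 ∧
      ((theta G)^[k] D).2.2 = true := by
    intro k
    induction k with
    | zero => intro _; exact ⟨rfl, rfl⟩
    | succ k ih =>
      intro hk
      obtain ⟨h1, h2⟩ := ih (by omega)
      have h4 := hB k
      have h5 : B (((theta G)^[k] D).1.symm (((theta G)^[k] D).2.1 + 1)) := by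
        by_contra hr
        exact hred _ hr k (by omega) (by simp)
      rw [Function.iterate_succ_apply']
      generalize (theta G)^[k] D = E at *
      obtain ⟨v, i, e⟩ := E
      dsimp only at h1 h2 h4 h5
      subst h2
      simp [theta, hG, h4, h5, h1, epsZ]
  have hz : ∑ k ∈ Finset.range P, disp ((theta G)^[k] D) a = 0 := hE D a
  have hs : ∑ k ∈ Finset.range P, disp ((theta G)^[k] D) a = ∑ k ∈ Finset.range P, 1 := by
    apply Finset.sum_congr rfl
    intro k hk
    unfold disp
    rw [if_pos (hcarry k (Finset.mem_range.1 hk).le).1]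
  rw [hs] at hz
  simp at hz
  omega

end Aux

/-- For all integers `n ≥ m ≥ 2` with `n ≥ 3`, the `n`-vertex complement
of the complete graph `K_m` is not ensnaring. -/
theorem stmt_15 (m n : ℕ) (hm : 2 ≤ m) (hmn : m ≤ n) (hn : 3 ≤ n) :
    ¬ Ensnaring (compln m n (⊤ : SimpleGraph (Fin m))) := by
  refine aux_main _ (fun x : Fin n => (x : ℕ) < m) ?_ (by simpa using hn)
    ⟨0, by omega⟩ ⟨1, by omega⟩ (by simp) (by simp; omega) (by simp; omega)
  intro a b
  simp only [compln, spread, SimpleGraph.compl_adj, SimpleGraph.fromRel_adj, SimpleGraph.top_adj,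
    ne_eq, Fin.mk.injEq, Fin.ext_iff]
  grind
end

section
/- Let (G; E_refl ⊔ E_refr) be a materialized graph on n ≥ 3 vertices. In every orbit O of the refractive–reflective toric promotion Θ, the two endpoints of any reflection edge have the same winding number: if {a,b} ∈ E_refl then w_O(a) = w_O(b). Consequently, if E_refr = ∅ and G is connected, then (G; E_refl ⊔ E_refr) is ensnaring. -/
open scoped Classical

/-- Refractive–reflective toric promotion `Θ` for a materialized graph whose reflection
edges form the graph `Gl` and whose refraction edges form the graph `Gr` (so the underlying
graph is `G = Gl ⊔ Gr`; `Gl` and `Gr` are assumed edge-disjoint):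
`Θ(v,i,ε) = (s̄ᵢ v, i+ε, ε)` if `{v⁻¹(i), v⁻¹(i+1)} ∉ E`;
`Θ(v,i,ε) = (s̄ᵢ v, i−ε, −ε)` if `{v⁻¹(i), v⁻¹(i+1)}` is a refraction edge; and
`Θ(v,i,ε) = (v, i+ε, ε)` if `{v⁻¹(i), v⁻¹(i+1)}` is a reflection edge. -/
noncomputable def thetaM {V : Type*} [Fintype V] (Gl Gr : SimpleGraph V) (D : Xi V) :
    Xi V :=
  if Gr.Adj (D.1.symm D.2.1) (D.1.symm (D.2.1 + 1)) then
    (D.1.trans (Equiv.swap D.2.1 (D.2.1 + 1)), D.2.1 - epsZ _ D.2.2, !D.2.2)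
  else if Gl.Adj (D.1.symm D.2.1) (D.1.symm (D.2.1 + 1)) then
    (D.1, D.2.1 + epsZ _ D.2.2, D.2.2)
  else
    (D.1.trans (Equiv.swap D.2.1 (D.2.1 + 1)), D.2.1 + epsZ _ D.2.2, D.2.2)

/-- The net number of clockwise steps that the replica of vertex `a` makes during one
application of `Θ` to the state `D`: reflection steps move no replicas, while the other
two kinds of steps swap the replicas at positions `i` and `i+1`. -/
noncomputable def dispM {V : Type*} [Fintype V] (Gl : SimpleGraph V) (D : Xi V) (a : V) :
    ℤ :=
  if Gl.Adj (D.1.symm D.2.1) (D.1.symm (D.2.1 + 1)) then 0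
  else if D.1 a = D.2.1 then 1 else if D.1 a = D.2.1 + 1 then -1 else 0

/-- `n` times the winding number of vertex `a` with respect to the orbit of `D` under `Θ`.
(The winding number itself is this quantity divided by `n`.) -/
noncomputable def windSumM {V : Type*} [Fintype V] (Gl Gr : SimpleGraph V) (D : Xi V)
    (a : V) : ℤ :=
  ∑ k ∈ Finset.range (Function.minimalPeriod (thetaM Gl Gr) D),
    dispM Gl ((thetaM Gl Gr)^[k] D) a

/-- The materialized graph `(Gl ⊔ Gr; Gl-edges reflective, Gr-edges refractive)` is
ensnaring if every orbit of `Θ` has winding vector `0`. -/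
def EnsnaringM {V : Type*} [Fintype V] (Gl Gr : SimpleGraph V) : Prop :=
  ∀ D : Xi V, ∀ a : V, windSumM Gl Gr D a = 0

/-- The materialized graph is expelling if no orbit of `Θ` has winding vector `0`. -/
def ExpellingM {V : Type*} [Fintype V] (Gl Gr : SimpleGraph V) : Prop :=
  ∀ D : Xi V, ¬ ∀ a : V, windSumM Gl Gr D a = 0

lemma aux_val {N : ℕ} [NeZero N] (y : ZMod N) (d : ℤ) (hd : -1 ≤ d) (hd' : d ≤ 1)
    (hy : y ≠ 0) (hyd : y + (d : ZMod N) ≠ 0) :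
    (((y + (d : ZMod N)).val : ℕ) : ℤ) = (y.val : ℤ) + d := by
  have h1 : y.val ≠ 0 := by rwa [Ne, ZMod.val_eq_zero]
  have h2 : y.val < N := ZMod.val_lt y
  have h3 : (y + (d : ZMod N)) = (((y.val : ℤ) + d : ℤ) : ZMod N) := by
    push_cast; rw [ZMod.natCast_zmod_val]
  have h4 : (y.val : ℤ) + d ≠ N := by
    intro h; apply hyd; rw [h3, h]; simp
  rw [h3, ZMod.val_intCast]
  apply Int.emod_eq_of_lt <;> omega

lemma aux_pos {V : Type*} [Fintype V] (Gl Gr : SimpleGraph V) (hdisj : Disjoint Gl Gr)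
    (h2 : 2 ≤ Fintype.card V) (D : Xi V) (a : V) :
    (thetaM Gl Gr D).1 a = D.1 a + ((dispM Gl D a : ℤ) : ZMod (Fintype.card V)) := by
  have hl : Gl.Adj (D.1.symm D.2.1) (D.1.symm (D.2.1 + 1)) →
      ¬ Gr.Adj (D.1.symm D.2.1) (D.1.symm (D.2.1 + 1)) := by
    intro h h'
    exact (SimpleGraph.disjoint_left.mp hdisj _ _ h) h'
  have hsw : Equiv.swap D.2.1 (D.2.1 + 1) (D.1 a) = D.1 a +
      (((if D.1 a = D.2.1 then 1 else if D.1 a = D.2.1 + 1 then -1 else 0 : ℤ)) :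
        ZMod (Fintype.card V)) := by
    rw [Equiv.swap_apply_def]
    split_ifs with h h' <;> simp [*]
  unfold thetaM dispM
  by_cases hL : Gl.Adj (D.1.symm D.2.1) (D.1.symm (D.2.1 + 1))
  · simp [hL, hl hL]
  · by_cases hR : Gr.Adj (D.1.symm D.2.1) (D.1.symm (D.2.1 + 1))
    · rw [if_pos hR, if_neg hL]; exact hsw
    · rw [if_neg hR, if_neg hL, if_neg hL]; exact hsw

lemma aux_gap {V : Type*} [Fintype V] (Gl Gr : SimpleGraph V) (hdisj : Disjoint Gl Gr)
    (h2 : 2 ≤ Fintype.card V) (D : Xi V) (a b : V) (hab : Gl.Adj a b) :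
    dispM Gl D b - dispM Gl D a =
      ((((thetaM Gl Gr D).1 b - (thetaM Gl Gr D).1 a).val : ℕ) : ℤ)
        - (((D.1 b - D.1 a).val : ℕ) : ℤ) := by
  haveI : NeZero (Fintype.card V) := ⟨by omega⟩
  have hne : ∀ E : Xi V, E.1 b - E.1 a ≠ 0 := by
    intro E h
    exact hab.ne' (E.1.injective (sub_eq_zero.mp h))
  have hE : (thetaM Gl Gr D).1 b - (thetaM Gl Gr D).1 a =
      (D.1 b - D.1 a) + ((dispM Gl D b - dispM Gl D a : ℤ) : ZMod (Fintype.card V)) := by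
    rw [aux_pos Gl Gr hdisj h2, aux_pos Gl Gr hdisj h2]; push_cast; ring
  have hba : -1 ≤ dispM Gl D b - dispM Gl D a ∧ dispM Gl D b - dispM Gl D a ≤ 1 := by
    have hx : D.1 a = D.2.1 → D.1 b = D.2.1 + 1 →
        Gl.Adj (D.1.symm D.2.1) (D.1.symm (D.2.1 + 1)) := by
      intro h h'; rw [← h', ← h]; simpa using hab
    have hx' : D.1 b = D.2.1 → D.1 a = D.2.1 + 1 →
        Gl.Adj (D.1.symm D.2.1) (D.1.symm (D.2.1 + 1)) := by
      intro h h'; rw [← h', ← h]; simpa using hab.symm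
    unfold dispM
    split_ifs <;> first | omega | (exfalso; tauto)
  have h0 := hne (thetaM Gl Gr D)
  rw [hE] at h0 ⊢
  rw [aux_val _ _ hba.1 hba.2 (hne D) h0]
  ring

lemma aux_sum {V : Type*} [Fintype V] (Gl : SimpleGraph V)
    (h2 : 2 ≤ Fintype.card V) (D : Xi V) : ∑ a, dispM Gl D a = 0 := by
  haveI : Fact (1 < Fintype.card V) := ⟨h2⟩
  unfold dispM
  by_cases hL : Gl.Adj (D.1.symm D.2.1) (D.1.symm (D.2.1 + 1))
  · simp [hL]
  · have key : ∀ a : V, (if D.1 a = D.2.1 then (1 : ℤ) else if D.1 a = D.2.1 + 1 then -1 else 0)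
        = (if a = D.1.symm D.2.1 then 1 else 0) - (if a = D.1.symm (D.2.1 + 1) then 1 else 0) := by
      intro a
      rw [Equiv.eq_symm_apply, Equiv.eq_symm_apply]
      by_cases h : D.1 a = D.2.1
      · simp [h]
      · by_cases h' : D.1 a = D.2.1 + 1 <;> simp [h']
    simp only [if_neg hL, key, Finset.sum_sub_distrib]
    simp

theorem aux_edge {V : Type*} [Fintype V] (Gl Gr : SimpleGraph V) (hdisj : Disjoint Gl Gr)
    (h2 : 2 ≤ Fintype.card V) (D : Xi V) (a b : V) (hab : Gl.Adj a b) :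
    windSumM Gl Gr D a = windSumM Gl Gr D b := by
  symm
  rw [← sub_eq_zero]
  unfold windSumM
  rw [← Finset.sum_sub_distrib]
  simp only [aux_gap Gl Gr hdisj h2 _ a b hab, ← Function.iterate_succ_apply']
  rw [Finset.sum_range_sub (fun k => (((((thetaM Gl Gr)^[k] D).1 b -
    ((thetaM Gl Gr)^[k] D).1 a).val : ℕ) : ℤ))]
  rw [Function.iterate_minimalPeriod]
  simp

/-- Let `(G; E_refl ⊔ E_refr)` be a materialized graph on `n ≥ 3`
vertices, with reflection edges forming the graph `Gl` and refraction edges forming the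
edge-disjoint graph `Gr`.  In every orbit of `Θ`, the two endpoints of any reflection edge
have the same winding number.  Consequently, if there are no refraction edges and the
underlying graph is connected, then the materialized graph is ensnaring. -/
theorem stmt_18 (n : ℕ) (hn : 3 ≤ n) (Gl Gr : SimpleGraph (Fin n))
    (hdisj : Disjoint Gl Gr) :
    (∀ (D : Xi (Fin n)) (a b : Fin n), Gl.Adj a b →
        windSumM Gl Gr D a = windSumM Gl Gr D b) ∧
      (Gr = ⊥ → (Gl ⊔ Gr).Connected → EnsnaringM Gl Gr) := by
  have h2 : 2 ≤ Fintype.card (Fin n) := by simp; omega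
  have hE := fun D a b => aux_edge Gl Gr hdisj h2 D a b
  refine ⟨hE, ?_⟩
  rintro rfl hc D a
  rw [sup_bot_eq] at hc
  have hall : ∀ b, windSumM Gl ⊥ D b = windSumM Gl ⊥ D a := by
    intro b
    obtain ⟨w⟩ := hc.preconnected b a
    induction w with
    | nil => rfl
    | cons h _ ih => exact (hE D _ _ h).trans ih
  have hs : ∑ b, windSumM Gl ⊥ D b = 0 := by
    unfold windSumM
    rw [Finset.sum_comm]
    exact Finset.sum_eq_zero fun k _ => aux_sum Gl h2 _
  simp only [hall] at hs
  simp at hs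
  rcases hs with h | h
  · omega
  · exact h
end

section
/- Let n ≥ 3 and let G = C_n be the cycle graph on n vertices, with edge set partitioned as E = E_refl ⊔ E_refr. The materialized graph (C_n; E_refl ⊔ E_refr) is ensnaring if |E_refr| is 0 or odd, and it is expelling otherwise (i.e., when |E_refr| is even and positive). -/
open scoped Classical

section aux

noncomputable section

def EE {V : Type*} [Fintype V] (D : Xi V) : ℤ := if D.2.2 then 1 else -1
def PP {V : Type*} [Fintype V] (D : Xi V) : ZMod (Fintype.card V) :=
  if D.2.2 then D.2.1 else D.2.1 + 1
def TT {V : Type*} [Fintype V] (D : Xi V) : V := D.1.symm (PP D)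
def UU {V : Type*} [Fintype V] (D : Xi V) : V := D.1.symm (PP D + (EE D : ZMod _))
def mvv {V : Type*} [Fintype V] (D : Xi V) (a : V) : ℤ :=
  if a = TT D then EE D else if a = UU D then - EE D else 0

lemma EE_or {V : Type*} [Fintype V] (D : Xi V) : EE D = 1 ∨ EE D = -1 := by
  unfold EE; split <;> simp

lemma vT {V : Type*} [Fintype V] (D : Xi V) : D.1 (TT D) = PP D := by simp [TT]
lemma vU {V : Type*} [Fintype V] (D : Xi V) : D.1 (UU D) = PP D + (EE D : ZMod _) := by simp [UU]

lemma castE_ne {V : Type*} [Fintype V] (hN : 3 ≤ Fintype.card V) (D : Xi V) :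
    (EE D : ZMod (Fintype.card V)) ≠ 0 := by
  have : Fact (1 < Fintype.card V) := ⟨by omega⟩
  rcases EE_or D with h | h <;> simp [h]

lemma T_ne_U {V : Type*} [Fintype V] (hN : 3 ≤ Fintype.card V) (D : Xi V) : TT D ≠ UU D := by
  intro h
  have := vT D
  rw [h, vU] at this
  exact castE_ne hN D (by simpa using this)

lemma step {V : Type*} [Fintype V] (hN : 3 ≤ Fintype.card V) (Gl Gr : SimpleGraph V)
    (hd : ∀ a b, Gl.Adj a b → ¬ Gr.Adj a b) (D : Xi V) :
    (Gr.Adj (TT D) (UU D) ∧ (∀ a, (thetaM Gl Gr D).1 a = D.1 a + (mvv D a : ZMod _)) ∧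
      PP (thetaM Gl Gr D) = PP D ∧ EE (thetaM Gl Gr D) = - EE D ∧ TT (thetaM Gl Gr D) = UU D ∧
      ∀ a, dispM Gl D a = mvv D a) ∨
    (Gl.Adj (TT D) (UU D) ∧ (∀ a, (thetaM Gl Gr D).1 a = D.1 a) ∧
      PP (thetaM Gl Gr D) = PP D + (EE D : ZMod _) ∧ EE (thetaM Gl Gr D) = EE D ∧
      TT (thetaM Gl Gr D) = UU D ∧
      ∀ a, dispM Gl D a = 0) ∨
    (¬ Gr.Adj (TT D) (UU D) ∧ ¬ Gl.Adj (TT D) (UU D) ∧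
      (∀ a, (thetaM Gl Gr D).1 a = D.1 a + (mvv D a : ZMod _)) ∧
      PP (thetaM Gl Gr D) = PP D + (EE D : ZMod _) ∧ EE (thetaM Gl Gr D) = EE D ∧
      TT (thetaM Gl Gr D) = TT D ∧
      ∀ a, dispM Gl D a = mvv D a) := by
  have hTU := T_ne_U hN D
  have key : ∀ x : ZMod (Fintype.card V), x + 1 ≠ x := by
    have : Fact (1 < Fintype.card V) := ⟨by omega⟩
    simp
  obtain ⟨v, i, e⟩ := D
  have hswap : ∀ a, Equiv.swap i (i+1) (v a) = v a + (mvv (v, i, e) a : ZMod _) := by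
    intro a
    rw [Equiv.swap_apply_def]
    cases e <;> simp only [mvv, TT, UU, PP, EE] <;> simp only [Equiv.eq_symm_apply] <;>
      simp <;> split_ifs <;> simp_all
  have hdisp : ¬ Gl.Adj (TT (v, i, e)) (UU (v, i, e)) → ∀ a, dispM Gl (v, i, e) a = mvv (v, i, e) a := by
    intro h a
    cases e
    · simp only [TT, UU, PP, EE, mvv, dispM] at h ⊢
      simp at h ⊢
      simp only [Equiv.eq_symm_apply]
      rw [SimpleGraph.adj_comm] at h
      simp only [h, if_false]
      split_ifs <;> simp_all
    · simp only [TT, UU, PP, EE, mvv, dispM] at h ⊢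
      simp at h ⊢
      simp only [Equiv.eq_symm_apply]
      simp only [h, if_false]
  have hG : ∀ G : SimpleGraph V, G.Adj (v.symm i) (v.symm (i+1)) ↔ G.Adj (TT (v, i, e)) (UU (v, i, e)) := by
    intro G
    cases e
    · simp [TT, UU, PP, EE, SimpleGraph.adj_comm]
    · simp [TT, UU, PP, EE]
  by_cases h1 : Gr.Adj (TT (v, i, e)) (UU (v, i, e))
  · left
    have hl : ¬ Gl.Adj (TT (v, i, e)) (UU (v, i, e)) := fun h => hd _ _ h h1
    refine ⟨h1, ?_, ?_, ?_, ?_, hdisp hl⟩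
    · intro a; simp only [thetaM, hG, h1, if_true]; exact hswap a
    · simp only [thetaM, hG, h1, if_true]; cases e <;> simp [PP, epsZ]
    · simp only [thetaM, hG, h1, if_true]; cases e <;> simp [EE]
    · simp only [thetaM, hG, h1, if_true]; cases e <;> simp [TT, UU, PP, EE, epsZ]
  · right
    by_cases h2 : Gl.Adj (TT (v, i, e)) (UU (v, i, e))
    · left
      refine ⟨h2, ?_, ?_, ?_, ?_, ?_⟩
      · intro a; simp only [thetaM, hG, h1, h2, if_true, if_false]
      · simp only [thetaM, hG, h1, h2, if_true, if_false]; cases e <;> simp [PP, EE, epsZ]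
      · simp only [thetaM, hG, h1, h2, if_true, if_false]; cases e <;> simp [EE]
      · simp only [thetaM, hG, h1, h2, if_true, if_false]; cases e <;> simp [TT, UU, PP, EE, epsZ]
      · intro a; simp [dispM, hG, h2]
    · right
      refine ⟨h1, h2, ?_, ?_, ?_, ?_, hdisp h2⟩
      · intro a; simp only [thetaM, hG, h1, h2, if_false]; exact hswap a
      · simp only [thetaM, hG, h1, h2, if_false]; cases e <;> simp [PP, EE, epsZ]
      · simp only [thetaM, hG, h1, h2, if_false]; cases e <;> simp [EE]
      · simp only [thetaM, hG, h1, h2, if_false]; cases e <;> simp [TT, PP, epsZ]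

lemma theta_inj {V : Type*} [Fintype V] (Gl Gr : SimpleGraph V) :
    Function.Injective (thetaM Gl Gr) := by
  have hidx : ∀ D : Xi V, D.2.1 = (thetaM Gl Gr D).2.1 - epsZ _ (thetaM Gl Gr D).2.2 := by
    intro D
    unfold thetaM
    split_ifs <;> cases D.2.2 <;> simp [epsZ]
  have hadj : ∀ (G : SimpleGraph V) (D : Xi V),
      G.Adj ((thetaM Gl Gr D).1.symm D.2.1) ((thetaM Gl Gr D).1.symm (D.2.1+1)) ↔
      G.Adj (D.1.symm D.2.1) (D.1.symm (D.2.1+1)) := by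
    intro G D
    unfold thetaM
    split_ifs <;> simp [SimpleGraph.adj_comm]
  intro D D' h
  have hi : D.2.1 = D'.2.1 := by rw [hidx D, hidx D', h]
  have hG : ∀ G : SimpleGraph V, G.Adj (D.1.symm D.2.1) (D.1.symm (D.2.1+1)) ↔
      G.Adj (D'.1.symm D'.2.1) (D'.1.symm (D'.2.1+1)) := by
    intro G
    rw [← hadj G D, ← hadj G D', h, hi]
  have hr := hG Gr
  have hl := hG Gl
  obtain ⟨v, i, e⟩ := D
  obtain ⟨v', i', e'⟩ := D'
  simp only at hi
  subst hi
  have hcancel : v.trans (Equiv.swap i (i+1)) = v'.trans (Equiv.swap i (i+1)) → v = v' := by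
    intro h
    ext a
    have := congrArg (fun f => f a) h
    simpa using this
  unfold thetaM at h
  simp only at h hr hl
  rw [hr, hl] at h
  split_ifs at h <;> simp only [Prod.mk.injEq] at h ⊢
  · exact ⟨hcancel h.1, trivial, by simpa using h.2.2⟩
  · exact ⟨h.1, trivial, h.2.2⟩
  · exact ⟨hcancel h.1, trivial, h.2.2⟩

lemma val_add_e {N : ℕ} (hN : 3 ≤ N) (x : ZMod N) (e : ℤ) (he : e = 1 ∨ e = -1) (hx : x ≠ 0)
    (hxe : x + (e : ZMod N) ≠ 0) : ((x + (e : ZMod N)).val : ℤ) = x.val + e := by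
  have : NeZero N := ⟨by omega⟩
  have h1 : ((x.val : ℤ) : ZMod N) = x := by simp
  have h0 : 0 < x.val := by
    rcases Nat.eq_zero_or_pos x.val with h | h
    · exact absurd ((ZMod.val_eq_zero x).1 h) hx
    · exact h
  have hlt := ZMod.val_lt x
  have h2 : (x + (e : ZMod N)) = (((x.val : ℤ) + e : ℤ) : ZMod N) := by push_cast; simp
  have h3 : (x.val : ℤ) + e ≠ N := by
    intro h
    rw [h] at h2; simp at h2; exact hxe h2
  rw [h2, ZMod.val_intCast, Int.emod_eq_of_lt] <;> omega



def XX {V : Type*} [Fintype V] (D : Xi V) (a b : V) : ℤ := ((D.1 b - D.1 a).val : ℤ)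

def crr {V : Type*} [Fintype V] (Gr : SimpleGraph V) (D : Xi V) (a b : V) : ℤ :=
  if Gr.Adj (TT D) (UU D) ∧ a = TT D ∧ b = UU D then - EE D
  else if Gr.Adj (TT D) (UU D) ∧ b = TT D ∧ a = UU D then EE D else 0

lemma val_one' {N : ℕ} (hN : 3 ≤ N) : ((1 : ZMod N).val : ℤ) = 1 := by
  have : Fact (1 < N) := ⟨by omega⟩
  simp [ZMod.val_one]

lemma val_neg_one' {N : ℕ} (hN : 3 ≤ N) : ((-1 : ZMod N).val : ℤ) = N - 1 := by
  obtain ⟨m, rfl⟩ : ∃ m, N = m + 1 := ⟨N - 1, by omega⟩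
  simp [ZMod.val_neg_one]

lemma XX_swap {V : Type*} [Fintype V] (hN : 3 ≤ Fintype.card V) (D D' : Xi V)
    (hv : ∀ a, D'.1 a = D.1 a + (mvv D a : ZMod _)) (a b : V) (hab : a ≠ b)
    (h1 : ¬ (a = TT D ∧ b = UU D)) (h2 : ¬ (b = TT D ∧ a = UU D)) :
    mvv D b - mvv D a = XX D' a b - XX D a b := by
  have hx : D.1 b - D.1 a ≠ 0 := fun h => hab (D.1.injective (sub_eq_zero.1 h)).symm
  have hx' : D'.1 b - D'.1 a ≠ 0 := fun h => hab (D'.1.injective (sub_eq_zero.1 h)).symm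
  have hmm : D'.1 b - D'.1 a = D.1 b - D.1 a + ((mvv D b - mvv D a : ℤ) : ZMod _) := by
    rw [hv, hv]; push_cast; ring
  have hcase : mvv D b - mvv D a = 0 ∨ mvv D b - mvv D a = 1 ∨ mvv D b - mvv D a = -1 := by
    have hTU := T_ne_U hN D
    unfold mvv
    rcases EE_or D with h | h <;> rw [h] <;> split_ifs <;> simp_all
  unfold XX
  rcases hcase with h | h
  · rw [hmm, h]; simp
  · rw [hmm] at hx' ⊢
    rw [val_add_e hN _ _ h hx hx']; ring

lemma XX_cross {V : Type*} [Fintype V] (hN : 3 ≤ Fintype.card V) (D D' : Xi V)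
    (hv : ∀ a, D'.1 a = D.1 a + (mvv D a : ZMod _)) :
    mvv D (UU D) - mvv D (TT D) = XX D' (TT D) (UU D) - XX D (TT D) (UU D)
      + Fintype.card V * (- EE D) ∧
    mvv D (TT D) - mvv D (UU D) = XX D' (UU D) (TT D) - XX D (UU D) (TT D)
      + Fintype.card V * (EE D) := by
  have hTU := T_ne_U hN D
  have mT : mvv D (TT D) = EE D := by simp [mvv]
  have mU : mvv D (UU D) = - EE D := by simp [mvv, hTU.symm]
  have a1 := val_one' hN
  have a2 := val_neg_one' hN
  unfold XX
  rw [hv, hv, mT, mU, vT, vU]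
  rcases EE_or D with h | h <;> rw [h] <;> simp <;> rw [a1, a2] <;> constructor <;> ring

section main
variable {V : Type*} [Fintype V] {Gl Gr : SimpleGraph V} {S : Equiv.Perm V}

lemma diff_lemma (hN : 3 ≤ Fintype.card V)
    (hd : ∀ a b, Gl.Adj a b → ¬ Gr.Adj a b)
    (D : Xi V) (a b : V) (hab : Gl.Adj a b ∨ Gr.Adj a b) :
    dispM Gl D b - dispM Gl D a = XX (thetaM Gl Gr D) a b - XX D a b
      + Fintype.card V * crr Gr D a b := by
  have hne : a ≠ b := by
    rcases hab with h | h <;> exact h.ne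
  have hTU := T_ne_U hN D
  rcases step hN Gl Gr hd D with ⟨h1, hv, -, -, -, hdp⟩ | ⟨h1, hv, -, -, -, hdp⟩ |
    ⟨h1, h2, hv, -, -, -, hdp⟩
  · rw [hdp, hdp]
    by_cases c1 : a = TT D ∧ b = UU D
    · obtain ⟨rfl, rfl⟩ := c1
      simp only [crr, h1, true_and, and_self, if_true]
      exact (XX_cross hN D _ hv).1
    · by_cases c2 : b = TT D ∧ a = UU D
      · obtain ⟨rfl, rfl⟩ := c2
        simp only [crr, h1, true_and, and_self, if_true, hTU.symm, false_and, if_false]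
        exact (XX_cross hN D _ hv).2
      · rw [XX_swap hN D _ hv a b hne c1 c2]
        simp [crr, c1, c2]
  · have h3 : ¬ Gr.Adj (TT D) (UU D) := hd _ _ h1
    rw [hdp, hdp]
    simp [crr, h3, XX, hv]
  · rw [hdp, hdp]
    have c1 : ¬ (a = TT D ∧ b = UU D) := by
      rintro ⟨rfl, rfl⟩; tauto
    have c2 : ¬ (b = TT D ∧ a = UU D) := by
      rintro ⟨rfl, rfl⟩; rw [Gl.adj_comm, Gr.adj_comm] at hab; tauto
    rw [XX_swap hN D _ hv a b hne c1 c2]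
    simp [crr, h1]

def YY (D : Xi V) (c : V) : ℕ := ((EE D : ZMod (Fintype.card V)) * (D.1 c - PP D)).val

def FF (S : Equiv.Perm V) (D : Xi V) : ℤ := if YY D (S (TT D)) < YY D (S.symm (TT D)) then 1 else -1

lemma EE_mul (D : Xi V) : (EE D : ZMod (Fintype.card V)) * (EE D : ZMod (Fintype.card V)) = 1 := by
  rcases EE_or D with h | h <;> simp [h]

lemma YY_inj (hN : 3 ≤ Fintype.card V) (D : Xi V) (c d : V) (h : YY D c = YY D d) : c = d := by
  have : NeZero (Fintype.card V) := ⟨by omega⟩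
  have h := ZMod.val_injective _ h
  have h2 := congrArg (fun x => (EE D : ZMod (Fintype.card V)) * x) h
  simp only [← mul_assoc, EE_mul, one_mul] at h2
  exact D.1.injective (by simpa using h2)

lemma YY_T (D : Xi V) : YY D (TT D) = 0 := by
  simp [YY, vT]

lemma YY_U (hN : 3 ≤ Fintype.card V) (D : Xi V) : YY D (UU D) = 1 := by
  have := val_one' hN
  simp only [YY, vU, add_sub_cancel_left, EE_mul]
  exact_mod_cast this

lemma YY_lt (hN : 3 ≤ Fintype.card V) (D : Xi V) (c : V) : YY D c < Fintype.card V := by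
  have : NeZero (Fintype.card V) := ⟨by omega⟩
  exact ZMod.val_lt _

lemma FF_of_U (hN : 3 ≤ Fintype.card V) (hS1 : ∀ a, S a ≠ a) (hS2 : ∀ a, S (S a) ≠ a)
    (D : Xi V) : (UU D = S (TT D) → FF S D = 1) ∧ (TT D = S (UU D) → FF S D = -1) := by
  have hU := YY_U hN D
  have hT := YY_T D
  have hTU := T_ne_U hN D
  constructor
  · intro h
    have n1 : YY D (S.symm (TT D)) ≠ YY D (TT D) := fun h' => by
      have := YY_inj hN D _ _ h'
      rw [Equiv.symm_apply_eq] at this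
      exact hS1 _ this.symm
    have n2 : YY D (S.symm (TT D)) ≠ YY D (UU D) := fun h' => by
      have := YY_inj hN D _ _ h'
      rw [Equiv.symm_apply_eq, h] at this
      exact hS2 _ this.symm
    unfold FF
    rw [← h, if_pos (by omega)]
  · intro h
    have n1 : YY D (S (TT D)) ≠ YY D (TT D) := fun h' => hS1 _ (YY_inj hN D _ _ h')
    unfold FF
    rw [if_neg]
    rw [show S.symm (TT D) = UU D by rw [Equiv.symm_apply_eq]; exact h]
    omega

lemma FF_of_max (hN : 3 ≤ Fintype.card V) (hS2 : ∀ a, S (S a) ≠ a)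
    (D : Xi V) (c : V) (hc : YY D c = Fintype.card V - 1) :
    (TT D = S c → FF S D = 1) ∧ (c = S (TT D) → FF S D = -1) := by
  constructor
  · intro h
    have n1 : YY D (S (TT D)) ≠ YY D c := fun h' => by
      have := YY_inj hN D _ _ h'
      rw [h] at this
      exact hS2 _ this
    have := YY_lt hN D (S (TT D))
    unfold FF
    rw [if_pos]
    rw [show S.symm (TT D) = c by rw [Equiv.symm_apply_eq]; exact h]
    omega
  · intro h
    have := YY_lt hN D (S.symm (TT D))
    unfold FF
    rw [← h, if_neg]
    omega

lemma YY_after (hN : 3 ≤ Fintype.card V)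
    (hd : ∀ a b, Gl.Adj a b → ¬ Gr.Adj a b) (D : Xi V)
    (h : Gl.Adj (TT D) (UU D) ∨ Gr.Adj (TT D) (UU D)) :
    YY (thetaM Gl Gr D) (TT D) = Fintype.card V - 1 ∧ TT (thetaM Gl Gr D) = UU D := by
  have a2 := val_neg_one' hN
  rcases step hN Gl Gr hd D with ⟨h1, hv, hP, hE, hT, hdp⟩ | ⟨h1, hv, hP, hE, hT, hdp⟩ |
    ⟨h1, h2, hv, hP, hE, hT, hdp⟩
  · refine ⟨?_, hT⟩
    unfold YY
    rw [hv, hP, hE, vT, show mvv D (TT D) = EE D by simp [mvv]]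
    push_cast
    rw [show -(EE D : ZMod (Fintype.card V)) * (PP D + (EE D : ZMod _) - PP D)
      = -((EE D : ZMod (Fintype.card V)) * (EE D : ZMod _)) by ring, EE_mul]
    omega
  · refine ⟨?_, hT⟩
    unfold YY
    rw [hv, hP, hE, vT]
    rw [show (EE D : ZMod (Fintype.card V)) * (PP D - (PP D + (EE D : ZMod _)))
      = -((EE D : ZMod (Fintype.card V)) * (EE D : ZMod _)) by ring, EE_mul]
    omega
  · tauto

lemma FF_inv (hN : 3 ≤ Fintype.card V)
    (hd : ∀ a b, Gl.Adj a b → ¬ Gr.Adj a b) (hS1 : ∀ a, S a ≠ a) (hS2 : ∀ a, S (S a) ≠ a)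
    (hadj : ∀ a b, (Gl.Adj a b ∨ Gr.Adj a b) ↔ (b = S a ∨ a = S b)) (D : Xi V) :
    FF S (thetaM Gl Gr D) = FF S D := by
  by_cases h : Gl.Adj (TT D) (UU D) ∨ Gr.Adj (TT D) (UU D)
  · obtain ⟨hY, hT⟩ := YY_after hN hd D h
    have A := FF_of_max (S := S) hN hS2 _ _ hY
    have B := FF_of_U (S := S) hN hS1 hS2 D
    rw [hT] at A
    rcases (hadj _ _).1 h with h | h
    · rw [A.1 h, B.1 h]
    · rw [A.2 h, B.2 h]
  · have hno := fun h' => h ((hadj _ _).2 h')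
    rcases step hN Gl Gr hd D with ⟨h1, hv, hP, hE, hT, hdp⟩ | ⟨h1, hv, hP, hE, hT, hdp⟩ |
      ⟨h1, h2, hv, hP, hE, hT, hdp⟩
    · tauto
    · tauto
    · have key : ∀ c, c ≠ TT D → c ≠ UU D → (YY (thetaM Gl Gr D) c : ℤ) = YY D c - 1 := by
        intro c hc1 hc2
        have h0 : YY D c ≠ 0 := fun h' => hc1 (YY_inj hN D _ _ (by rw [h', YY_T]))
        have h1 : YY D c ≠ 1 := fun h' => hc2 (YY_inj hN D _ _ (by rw [h', YY_U hN]))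
        have : NeZero (Fintype.card V) := ⟨by omega⟩
        have e1 : (EE D : ZMod (Fintype.card V)) * (D.1 c - (PP D + (EE D : ZMod _)))
            = (EE D : ZMod (Fintype.card V)) * (D.1 c - PP D) + ((-1 : ℤ) : ZMod _) := by
          push_cast
          rw [← EE_mul D]; ring
        unfold YY at *
        rw [hv, hP, hE, show mvv D c = 0 by simp [mvv, hc1, hc2]]
        simp only [Int.cast_zero, add_zero]
        rw [e1, val_add_e hN _ _ (Or.inr rfl)]
        · ring
        · intro h'; exact h0 (by rw [h']; simp)
        · intro h'
          apply h1
          have : (EE D : ZMod (Fintype.card V)) * (D.1 c - PP D) = 1 := by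
            push_cast at h'
            exact add_neg_eq_zero.1 h'
          rw [this]
          exact_mod_cast val_one' hN
      have k1 := key (S (TT D)) (hS1 _) (fun h => hno (Or.inl h.symm))
      have k2 := key (S.symm (TT D)) (fun h => hS1 (TT D) (by rw [Equiv.symm_apply_eq] at h; exact h.symm))
        (fun h => hno (Or.inr (by rw [Equiv.symm_apply_eq] at h; exact h)))
      unfold FF
      rw [hT]
      have : YY (thetaM Gl Gr D) (S (TT D)) < YY (thetaM Gl Gr D) (S.symm (TT D)) ↔
        YY D (S (TT D)) < YY D (S.symm (TT D)) := by omega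
      simp only [this]

lemma sum_zero (hN : 3 ≤ Fintype.card V) (hd : ∀ a b, Gl.Adj a b → ¬ Gr.Adj a b) (D : Xi V) :
    ∑ a, dispM Gl D a = 0 := by
  have hTU := T_ne_U hN D
  have : ∑ a, mvv D a = 0 := by
    have : ∀ a, mvv D a = (if a = TT D then EE D else 0) + (if a = UU D then - EE D else 0) := by
      intro a
      unfold mvv
      split_ifs <;> simp_all
    simp [this, Finset.sum_add_distrib]
  rcases step hN Gl Gr hd D with ⟨h1, hv, hP, hE, hT, hdp⟩ | ⟨h1, hv, hP, hE, hT, hdp⟩ |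
    ⟨h1, h2, hv, hP, hE, hT, hdp⟩ <;> simp [hdp, this]

/-- telescoping -/
lemma tele {α : Type*} (f : α → α) (x : α) (Φ : α → ℤ) :
    ∑ k ∈ Finset.range (Function.minimalPeriod f x), (Φ (f (f^[k] x)) - Φ (f^[k] x)) = 0 := by
  have : ∀ k, Φ (f (f^[k] x)) - Φ (f^[k] x) = (fun k => Φ (f^[k] x)) (k+1) - (fun k => Φ (f^[k] x)) k := by
    intro k; simp only [Function.iterate_succ_apply']
  rw [Finset.sum_congr rfl (fun k _ => this k), Finset.sum_range_sub (fun k => Φ (f^[k] x))]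
  simp

lemma wind_diff (hN : 3 ≤ Fintype.card V) (hd : ∀ a b, Gl.Adj a b → ¬ Gr.Adj a b) (D : Xi V)
    (a b : V) (hab : Gl.Adj a b ∨ Gr.Adj a b) :
    windSumM Gl Gr D b - windSumM Gl Gr D a = Fintype.card V *
      ∑ k ∈ Finset.range (Function.minimalPeriod (thetaM Gl Gr) D),
        crr Gr ((thetaM Gl Gr)^[k] D) a b := by
  have := tele (thetaM Gl Gr) D (fun D => XX D a b)
  unfold windSumM
  rw [← Finset.sum_sub_distrib, Finset.mul_sum]
  simp only [diff_lemma hN hd _ a b hab]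
  rw [Finset.sum_add_distrib, this, zero_add]

lemma wind_sum (hN : 3 ≤ Fintype.card V) (hd : ∀ a b, Gl.Adj a b → ¬ Gr.Adj a b) (D : Xi V) :
    ∑ a, windSumM Gl Gr D a = 0 := by
  unfold windSumM
  rw [Finset.sum_comm]
  simp [sum_zero hN hd]

lemma crr_refl (hd : ∀ a b, Gl.Adj a b → ¬ Gr.Adj a b) (D : Xi V) (a b : V) (hab : Gl.Adj a b) :
    crr Gr D a b = 0 := by
  have h1 := hd _ _ hab
  have h2 := hd _ _ hab.symm
  unfold crr
  rw [if_neg, if_neg]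
  · rintro ⟨h, rfl, rfl⟩; exact h2 h
  · rintro ⟨h, rfl, rfl⟩; exact h1 h

/-- odd case, crossing a refraction edge -/
lemma crr_odd (hN : 3 ≤ Fintype.card V)
    (hd : ∀ a b, Gl.Adj a b → ¬ Gr.Adj a b) (hS1 : ∀ a, S a ≠ a) (hS2 : ∀ a, S (S a) ≠ a)
    (hadj : ∀ a b, (Gl.Adj a b ∨ Gr.Adj a b) ↔ (b = S a ∨ a = S b)) (j : V)
    (hj : Gr.Adj j (S j)) (σ : V → ℤ) (hσj : σ j = 1) (hσj' : σ (S j) = 1)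
    (hσ : ∀ a, a ≠ j → σ (S a) = if Gr.Adj a (S a) then - σ a else σ a) (D : Xi V) :
    2 * crr Gr D j (S j) = FF S (thetaM Gl Gr D) * (EE (thetaM Gl Gr D) * σ (TT (thetaM Gl Gr D)))
      - FF S D * (EE D * σ (TT D)) := by
  rw [FF_inv hN hd hS1 hS2 hadj]
  have B := FF_of_U (S := S) hN hS1 hS2 D
  rcases step hN Gl Gr hd D with ⟨h1, hv, hP, hE, hT, hdp⟩ | ⟨h1, hv, hP, hE, hT, hdp⟩ |
      ⟨h1, h2, hv, hP, hE, hT, hdp⟩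
  · rw [hE, hT]
    rcases (hadj _ _).1 (Or.inr h1) with h | h
    · rw [B.1 h]
      by_cases hTj : TT D = j
      · have : UU D = S j := by rw [h, hTj]
        have e1 : crr Gr D j (S j) = - EE D := by
          unfold crr
          rw [if_pos]
          exact ⟨h1, hTj.symm, this.symm⟩
        rw [e1, this, hTj, hσj, hσj']; ring
      · have h3 := hσ _ hTj
        rw [← h, if_pos h1] at h3
        rw [h3]
        have c1 : ¬ (S j = TT D ∧ j = UU D) := by
          rintro ⟨e1, e2⟩; rw [e2] at e1; rw [← e1] at h; exact hS2 _ h.symm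
        simp [crr, c1, Ne.symm hTj]
    · rw [B.2 h]
      by_cases hUj : UU D = j
      · have : TT D = S j := by rw [h, hUj]
        have e1 : crr Gr D j (S j) = EE D := by
          unfold crr
          rw [if_neg, if_pos]
          · exact ⟨h1, this.symm, hUj.symm⟩
          · rintro ⟨-, e, -⟩; exact hS1 j (by rw [← this, ← e])
        rw [e1, this, hUj, hσj, hσj']; ring
      · have h3 := hσ _ hUj
        rw [← h, if_pos h1.symm] at h3
        rw [h3]
        have c1 : ¬ (j = TT D ∧ S j = UU D) := by
          rintro ⟨e1, e2⟩; rw [← e2, ← e1] at h; exact hS2 _ h.symm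
        simp [crr, c1, Ne.symm hUj]
  · have h3 : ¬ Gr.Adj (TT D) (UU D) := hd _ _ h1
    have e1 : σ (UU D) = σ (TT D) := by
      rcases (hadj _ _).1 (Or.inl h1) with h | h
      · have := hσ (TT D) (by rintro rfl; rw [h] at h3; exact h3 hj)
        rwa [← h, if_neg h3] at this
      · have := hσ (UU D) (by rintro rfl; rw [h] at h3; exact h3 hj.symm)
        rw [← h, if_neg (fun h => h3 h.symm)] at this
        exact this.symm
    rw [hE, hT, e1]
    simp [crr, h3]
  · rw [hE, hT]
    simp [crr, h1]

lemma eta_even (hN : 3 ≤ Fintype.card V)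
    (hd : ∀ a b, Gl.Adj a b → ¬ Gr.Adj a b)
    (hadj : ∀ a b, (Gl.Adj a b ∨ Gr.Adj a b) ↔ (b = S a ∨ a = S b)) (σ : V → ℤ)
    (hσ : ∀ a, σ (S a) = if Gr.Adj a (S a) then - σ a else σ a) (D : Xi V) :
    EE (thetaM Gl Gr D) * σ (TT (thetaM Gl Gr D)) = EE D * σ (TT D) := by
  have hσr : ∀ a b, Gr.Adj a b → σ b = - σ a := by
    intro a b h
    rcases (hadj a b).1 (Or.inr h) with h' | h'
    · rw [h', hσ, if_pos (h' ▸ h)]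
    · have := hσ b
      rw [← h', if_pos h.symm] at this
      omega
  have hσl : ∀ a b, Gl.Adj a b → σ b = σ a := by
    intro a b h
    have h3 := hd _ _ h
    rcases (hadj a b).1 (Or.inl h) with h' | h'
    · rw [h', hσ, if_neg (h' ▸ h3)]
    · have := hσ b
      rw [← h', if_neg (fun h => h3 h.symm)] at this
      omega
  rcases step hN Gl Gr hd D with ⟨h1, hv, hP, hE, hT, hdp⟩ | ⟨h1, hv, hP, hE, hT, hdp⟩ |
      ⟨h1, h2, hv, hP, hE, hT, hdp⟩
  · rw [hE, hT, hσr _ _ h1]; ring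
  · rw [hE, hT, hσl _ _ h1]
  · rw [hE, hT]

lemma crr_even (hS1 : ∀ a, S a ≠ a) (j : V) (hj : Gr.Adj j (S j)) (σ : V → ℤ)
    (hσ1 : ∀ a, σ a * σ a = 1)
    (hσ : ∀ a, σ (S a) = if Gr.Adj a (S a) then - σ a else σ a) (D : Xi V) :
    crr Gr D j (S j) * (-((EE D * σ (TT D)) * σ j)) =
      if (j = TT D ∧ S j = UU D) ∨ (S j = TT D ∧ j = UU D) then 1 else 0 := by
  have hE : EE D * EE D = 1 := by rcases EE_or D with h | h <;> rw [h] <;> norm_num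
  by_cases c1 : j = TT D ∧ S j = UU D
  · rw [if_pos (Or.inl c1)]
    unfold crr
    rw [if_pos ⟨by rw [← c1.1, ← c1.2]; exact hj, c1⟩, ← c1.1]
    linear_combination (σ j * σ j) * hE + hσ1 j
  · by_cases c2 : S j = TT D ∧ j = UU D
    · rw [if_pos (Or.inr c2)]
      unfold crr
      rw [if_neg (by tauto), if_pos ⟨by rw [← c2.1, ← c2.2]; exact hj.symm, c2⟩, ← c2.1, hσ j,
        if_pos hj]
      linear_combination (σ j * σ j) * hE + hσ1 j
    · simp [crr, c1, c2]

lemma expel (hN : 3 ≤ Fintype.card V)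
    (hd : ∀ a b, Gl.Adj a b → ¬ Gr.Adj a b) (hS1 : ∀ a, S a ≠ a)
    (hadj : ∀ a b, (Gl.Adj a b ∨ Gr.Adj a b) ↔ (b = S a ∨ a = S b)) (j : V)
    (hj : Gr.Adj j (S j)) (σ : V → ℤ)
    (hσ1 : ∀ a, σ a * σ a = 1)
    (hσ : ∀ a, σ (S a) = if Gr.Adj a (S a) then - σ a else σ a) : ExpellingM Gl Gr := by
  intro D hw
  have hNe : NeZero (Fintype.card V) := ⟨by omega⟩
  set f := thetaM Gl Gr with hf
  set P := Function.minimalPeriod f D with hPdef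
  have hPpos : 0 < P := by
    apply Function.minimalPeriod_pos_of_mem_periodicPts
    exact Function.Injective.mem_periodicPts (theta_inj Gl Gr) D
  have hext : ∀ (Q : Xi V → Prop), (∀ k < P, Q (f^[k] D)) → ∀ k, Q (f^[k] D) := by
    intro Q h k
    have := h (k % P) (Nat.mod_lt _ hPpos)
    rwa [hPdef, Function.iterate_mod_minimalPeriod_eq] at this
  have heta : ∀ k, EE (f^[k] D) * σ (TT (f^[k] D)) = EE D * σ (TT D) := by
    intro k
    induction k with
    | zero => rfl
    | succ k ih => rw [Function.iterate_succ_apply', ← ih]; exact eta_even hN hd hadj σ hσ _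
  have hno1 : ∀ i, Gr.Adj i (S i) → ∀ k,
      ¬ ((i = TT (f^[k] D) ∧ S i = UU (f^[k] D)) ∨ (S i = TT (f^[k] D) ∧ i = UU (f^[k] D))) := by
    intro i hi
    apply hext (fun D => ¬ ((i = TT D ∧ S i = UU D) ∨ (S i = TT D ∧ i = UU D)))
    have h1 := wind_diff hN hd D i (S i) (Or.inr hi)
    rw [hw, hw, sub_zero] at h1
    have h2 : ∑ k ∈ Finset.range P, crr Gr (f^[k] D) i (S i) = 0 := by
      rcases mul_eq_zero.1 h1.symm with h | h
      · have : Fintype.card V = 0 := by exact_mod_cast h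
        omega
      · exact h
    have h3 : ∑ k ∈ Finset.range P, (if (i = TT (f^[k] D) ∧ S i = UU (f^[k] D)) ∨
        (S i = TT (f^[k] D) ∧ i = UU (f^[k] D)) then (1 : ℤ) else 0) = 0 := by
      have : ∀ k ∈ Finset.range P, (if (i = TT (f^[k] D) ∧ S i = UU (f^[k] D)) ∨
        (S i = TT (f^[k] D) ∧ i = UU (f^[k] D)) then (1 : ℤ) else 0) =
          crr Gr (f^[k] D) i (S i) * (-((EE D * σ (TT D)) * σ i)) := by
        intro k _
        rw [← crr_even hS1 i hi σ hσ1 hσ, heta]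
      rw [Finset.sum_congr rfl this, ← Finset.sum_mul, h2, zero_mul]
    rw [Finset.sum_eq_zero_iff_of_nonneg (by intro k _; split_ifs <;> norm_num)] at h3
    intro k hk hc
    have := h3 k (Finset.mem_range.2 hk)
    rw [if_pos hc] at this
    norm_num at this
  have hno : ∀ k, ¬ Gr.Adj (TT (f^[k] D)) (UU (f^[k] D)) := by
    intro k h
    rcases (hadj _ _).1 (Or.inr h) with h' | h'
    · exact hno1 (TT (f^[k] D)) (h' ▸ h) k (Or.inl ⟨rfl, h'.symm⟩)
    · exact hno1 (UU (f^[k] D)) (by have := h.symm; rwa [h'] at this) k (Or.inr ⟨h'.symm, rfl⟩)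
  have hstep := fun k => step hN Gl Gr hd (f^[k] D)
  have hE : ∀ k, EE (f^[k] D) = EE D := by
    intro k
    induction k with
    | zero => rfl
    | succ k ih =>
      rw [Function.iterate_succ_apply', ← ih]
      rcases hstep k with ⟨h1, -⟩ | ⟨h1, hv, hP, hE, hT, hdp⟩ | ⟨h1, h2, hv, hP, hE, hT, hdp⟩
      · exact absurd h1 (hno k)
      · exact hE
      · exact hE
  have hE0 : EE D ≠ 0 := by rcases EE_or D with h | h <;> rw [h] <;> norm_num
  have hP : ∀ k : ℕ, PP (f^[k] D) = PP D + (k : ZMod (Fintype.card V)) * (EE D : ZMod _) := by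
    intro k
    induction k with
    | zero => simp
    | succ k ih =>
      rw [Function.iterate_succ_apply']
      have e : PP (f (f^[k] D)) = PP (f^[k] D) + (EE (f^[k] D) : ZMod _) := by
        rcases hstep k with ⟨h1, -⟩ | ⟨h1, hv, hP, hE, hT, hdp⟩ | ⟨h1, h2, hv, hP, hE, hT, hdp⟩
        · exact absurd h1 (hno k)
        · exact hP
        · exact hP
      rw [e, ih, hE]; push_cast; ring
  have hσT : ∀ k, σ (TT (f^[k] D)) = σ (TT D) := by
    intro k
    have := heta k
    rw [hE] at this
    exact mul_left_cancel₀ hE0 this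
  obtain ⟨a, ha⟩ : ∃ a, σ a ≠ σ (TT D) := by
    by_contra! h
    have h1 := hσ j
    rw [if_pos hj, h (S j), h j] at h1
    have h2 := hσ1 (TT D)
    have h3 : σ (TT D) = 0 := by omega
    rw [h3] at h2
    norm_num at h2
  have haT : ∀ k, a ≠ TT (f^[k] D) := by
    intro k h
    exact ha (by rw [h, hσT])
  have hnn : ∀ k, 0 ≤ - EE D * dispM Gl (f^[k] D) a := by
    intro k
    have hm : 0 ≤ - EE D * mvv (f^[k] D) a := by
      unfold mvv
      rw [if_neg (haT k), hE]
      split_ifs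
      · nlinarith
      · simp
    rcases hstep k with ⟨h1, -⟩ | ⟨h1, hv, hP, hE, hT, hdp⟩ | ⟨h1, h2, hv, hP, hE, hT, hdp⟩
    · exact absurd h1 (hno k)
    · rw [hdp]; simp
    · rw [hdp]; exact hm
  have hd0 : ∀ k, dispM Gl (f^[k] D) a = 0 := by
    apply hext (fun D => dispM Gl D a = 0)
    have h1 : ∑ k ∈ Finset.range P, - EE D * dispM Gl (f^[k] D) a = 0 := by
      rw [← Finset.mul_sum]
      have := hw a
      unfold windSumM at this
      rw [this, mul_zero]
    rw [Finset.sum_eq_zero_iff_of_nonneg (fun k _ => hnn k)] at h1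
    intro k hk
    have := h1 k (Finset.mem_range.2 hk)
    rcases mul_eq_zero.1 this with h | h
    · omega
    · exact h
  have hva : ∀ k, (f^[k] D).1 a = D.1 a := by
    intro k
    induction k with
    | zero => rfl
    | succ k ih =>
      rw [Function.iterate_succ_apply', ← ih]
      rcases hstep k with ⟨h1, -⟩ | ⟨h1, hv, hP, hE, hT, hdp⟩ | ⟨h1, h2, hv, hP, hE, hT, hdp⟩
      · exact absurd h1 (hno k)
      · exact hv a
      · rw [hv a, ← hdp, hd0]; simp
  obtain ⟨k, hk⟩ : ∃ k : ℕ, PP D + (k : ZMod (Fintype.card V)) * (EE D : ZMod _) + (EE D : ZMod _)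
      = D.1 a := by
    refine ⟨((D.1 a - PP D - (EE D : ZMod _)) * (EE D : ZMod _)).val, ?_⟩
    rw [ZMod.natCast_zmod_val]
    linear_combination (D.1 a - PP D - (EE D : ZMod (Fintype.card V))) * EE_mul D
  have hU : UU (f^[k] D) = a := by
    apply (f^[k] D).1.injective
    rw [vU, hva, hP, hE, hk]
  rcases hstep k with ⟨h1, -⟩ | ⟨h1, hv, hP, hE, hT, hdp⟩ | ⟨h1, h2, hv, hP, hE', hT, hdp⟩
  · exact absurd h1 (hno k)
  · apply haT (k+1)
    rw [Function.iterate_succ_apply', ← hU]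
    exact hT.symm
  · have := hdp a
    rw [hd0, mvv, if_neg (haT k), if_pos hU.symm, hE] at this
    omega

end main

end

end aux

lemma exists_sigma (m : ℕ) (s : Fin (m+1) → ℤˣ) (hs : ∏ a, s a = 1) :
    ∃ σ : Fin (m+1) → ℤˣ, ∀ a, σ (a+1) = σ a * s a := by
  refine ⟨fun a => ∏ i ∈ Finset.range a.val, s (Fin.ofNat (m+1) i), ?_⟩
  intro a
  have key : (∏ i ∈ Finset.range a.val, s (Fin.ofNat (m+1) i)) * s a =
      ∏ i ∈ Finset.range (a.val + 1), s (Fin.ofNat (m+1) i) := by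
    rw [Finset.prod_range_succ]
    congr 2
    ext; simp [Nat.mod_eq_of_lt a.2]
  simp only
  rw [key]
  by_cases h : a = Fin.last m
  · subst h
    rw [Fin.last_add_one]
    simp only [Fin.val_zero, Finset.range_zero, Finset.prod_empty, Fin.val_last]
    rw [← hs, ← Fin.prod_univ_eq_prod_range (fun i => s (Fin.ofNat (m+1) i))]
    apply Finset.prod_congr rfl
    intro i _
    congr 1
    ext; simp [Nat.mod_eq_of_lt i.2]
  · rw [Fin.val_add_one, if_neg h]

lemma ncard_eq (m : ℕ) (Gl Gr : SimpleGraph (Fin (m+3)))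
    (hadj : ∀ a b, (Gl.Adj a b ∨ Gr.Adj a b) ↔ (b = a + 1 ∨ a = b + 1)) :
    Gr.edgeSet.ncard = (Finset.univ.filter (fun a : Fin (m+3) => Gr.Adj a (a+1))).card := by
  rw [← Set.ncard_coe_finset]
  symm
  have hS2 : ∀ a : Fin (m+3), a + 1 + 1 ≠ a := by
    intro a h
    rw [add_assoc] at h
    have h := add_eq_left.1 h
    have := congrArg Fin.val h
    rw [Fin.val_add] at this
    simp at this
    rw [Nat.mod_eq_of_lt (by omega)] at this
    omega
  refine Set.ncard_congr (fun a _ => s(a, a+1)) ?_ ?_ ?_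
  · intro a ha
    simpa using ha
  · intro a b _ _ h
    rw [Sym2.eq_iff] at h
    rcases h with h | ⟨h1, h2⟩
    · exact h.1
    · exfalso
      rw [h1] at h2
      exact hS2 _ h2
  · intro e he
    induction e using Sym2.ind with
    | _ x y =>
      rw [SimpleGraph.mem_edgeSet] at he
      rcases (hadj x y).1 (Or.inr he) with h | h
      · exact ⟨x, by simpa [h] using he, by rw [h]⟩
      · exact ⟨y, by simpa [h] using he.symm, by rw [h, Sym2.eq_swap]⟩

theorem stmt_19 (n : ℕ) (hn : 3 ≤ n) (Gl Gr : SimpleGraph (Fin n))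
    (hdisj : Disjoint Gl Gr) (hunion : Gl ⊔ Gr = SimpleGraph.cycleGraph n) :
    ((Gr.edgeSet.ncard = 0 ∨ Odd Gr.edgeSet.ncard) → EnsnaringM Gl Gr) ∧
      ((Gr.edgeSet.ncard ≠ 0 ∧ Even Gr.edgeSet.ncard) → ExpellingM Gl Gr) := by
  obtain ⟨m, rfl⟩ : ∃ m, n = m + 3 := ⟨n - 3, by omega⟩
  have hN : 3 ≤ Fintype.card (Fin (m+3)) := by simp
  have hadj : ∀ a b, (Gl.Adj a b ∨ Gr.Adj a b) ↔ (b = a + 1 ∨ a = b + 1) := by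
    intro a b
    have : (Gl ⊔ Gr).Adj a b ↔ (Gl.Adj a b ∨ Gr.Adj a b) := Iff.rfl
    rw [← this, hunion, SimpleGraph.cycleGraph_adj, sub_eq_iff_eq_add', sub_eq_iff_eq_add', or_comm,
      add_comm b, add_comm a]
  have hd : ∀ a b, Gl.Adj a b → ¬ Gr.Adj a b := by
    intro a b h1 h2
    have : (Gl ⊓ Gr).Adj a b := ⟨h1, h2⟩
    rw [hdisj.eq_bot] at this
    exact this
  have hS1 : ∀ a : Fin (m+3), a + 1 ≠ a := by simp
  have hS2 : ∀ a : Fin (m+3), a + 1 + 1 ≠ a := by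
    intro a h
    rw [add_assoc] at h
    have h := add_eq_left.1 h
    have := congrArg Fin.val h
    rw [Fin.val_add] at this
    simp at this
    rw [Nat.mod_eq_of_lt (by omega)] at this
    omega
  have hcard := ncard_eq m Gl Gr hadj
  set s : Fin (m+3) → ℤˣ := fun a => if Gr.Adj a (a+1) then -1 else 1 with hs
  have hprod : ∏ a, s a = (-1) ^ Gr.edgeSet.ncard := by
    rw [hcard, hs, Finset.prod_ite]
    simp
  set S : Equiv.Perm (Fin (m+3)) := Equiv.addRight 1 with hSdef
  have hSa : ∀ a, S a = a + 1 := fun a => rfl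
  constructor
  · intro hk D
    have hdiff : ∀ a, windSumM Gl Gr D (a+1) = windSumM Gl Gr D a := by
      intro a
      have hw := wind_diff hN hd D a (a+1) ((hadj _ _).2 (Or.inl rfl))
      by_cases hl : Gr.Adj a (a+1)
      · have hodd : Odd Gr.edgeSet.ncard := by
          rcases hk with h | h
          · rw [hcard, Finset.card_eq_zero] at h
            have : a ∈ Finset.univ.filter (fun a : Fin (m+3) => Gr.Adj a (a+1)) := by simp [hl]
            rw [h] at this
            simp at this
          · exact h
        have hsa : s a = -1 := by simp [hs, hl]
        obtain ⟨σ, hσ⟩ := exists_sigma (m+2) (Function.update s a 1) (by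
          rw [Finset.prod_update_of_mem (Finset.mem_univ a), one_mul]
          have := Finset.mul_prod_erase Finset.univ s (Finset.mem_univ a)
          rw [hprod, hodd.neg_one_pow, hsa] at this
          rw [Finset.sdiff_singleton_eq_erase]
          simpa using this)
        have hc := crr_odd (S := S) hN hd hS1 hS2 hadj a hl (fun b => ((σ a * σ b : ℤˣ) : ℤ))
          (by simp [← Units.val_mul]) (by
            have := hσ a
            simp only [Function.update_self, mul_one] at this
            simp only [hSa, this, Int.units_mul_self, Units.val_one]) (by
            intro b hb
            have := hσ b
            rw [Function.update_of_ne hb] at this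
            simp only [hSa, this, hs]
            split_ifs <;> simp)
        have ht := tele (thetaM Gl Gr) D (fun D => FF S D * (EE D * ((σ a * σ (TT D) : ℤˣ) : ℤ)))
        simp only [← hc, ← Finset.mul_sum] at ht
        have ht2 := (mul_eq_zero.1 ht).resolve_left (by norm_num)
        have hw : windSumM Gl Gr D (a+1) - windSumM Gl Gr D a = (Fintype.card (Fin (m+3)) : ℤ) * 0 := by
          rw [← ht2]; exact hw
        linarith
      · have hl' : Gl.Adj a (a+1) := ((hadj a (a+1)).2 (Or.inl rfl)).resolve_right hl
        simp only [crr_refl hd _ _ _ hl'] at hw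
        simp at hw
        linarith
    have hconst : ∀ k : ℕ, windSumM Gl Gr D (Fin.ofNat (m+3) k) = windSumM Gl Gr D 0 := by
      intro k
      induction k with
      | zero => rfl
      | succ k ih =>
        rw [← ih, ← hdiff (Fin.ofNat (m+3) k)]
        congr 1
        ext; simp [Fin.val_add]
    have hconst' : ∀ a, windSumM Gl Gr D a = windSumM Gl Gr D 0 := by
      intro a
      rw [← hconst a.val]
      congr 1
      ext; simp [Nat.mod_eq_of_lt a.2]
    have hsum := wind_sum hN hd D
    simp only [hconst'] at hsum
    simp at hsum
    intro a
    rw [hconst']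
    rcases hsum with h | h
    · omega
    · exact h
  · rintro ⟨hk, heven⟩
    obtain ⟨j, hj⟩ : ∃ j, Gr.Adj j (j+1) := by
      rw [hcard] at hk
      obtain ⟨j, hj⟩ := Finset.card_pos.1 (Nat.pos_of_ne_zero hk)
      exact ⟨j, by simpa using hj⟩
    obtain ⟨σ, hσ⟩ := exists_sigma (m+2) s (by rw [hprod, heven.neg_one_pow])
    refine expel (S := S) hN hd hS1 hadj j hj (fun a => (σ a : ℤ)) ?_ ?_
    · intro a
      simp [← Units.val_mul]
    · intro a
      simp only [hSa, hσ, hs]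
      split_ifs <;> simp
end
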